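/- arXiv:2605.21853 — 3 statements merged into one kernel-verified Lean document; each statement's English description precedes it below -/
import Mathlib

section
/- Suppose a_g ≥ ā > 0 for all g ∈ E. For a nonempty proper subset F ⊊ E define a(F) := Σ_{g∈F} a_g, S(F) := {v ∈ V : every edge of G incident to v belongs to F}, κ(G∖F) := the number of connected components of the graph (V, E∖F), and A(F) := a(F) − Σ_{v∈S(F)} b_v + (κ(G∖F) − 1)/2. Then A(F) ≥ ā/2. -/
open MeasureTheory Real Filter
open scoped ENNReal NNReal Classical BigOperators

noncomputable section

namespace ERRW

variable {V : Type*} [Fintype V] [DecidableEq V]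

/-- Total weight at a vertex: sum of the edge weights over the edges incident to `i`. -/
def vw (G : SimpleGraph V) [DecidableRel G.Adj] (w : Sym2 V → ℝ) (i : V) : ℝ :=
  ∑ j ∈ G.neighborFinset i, w s(i, j)

/-- Product of a vertex function over the two endpoints of an unordered pair. -/
def sprod (f : V → ℝ) : Sym2 V → ℝ :=
  Sym2.lift ⟨fun i j => f i * f j, fun i j => mul_comm _ _⟩

/-- Sum of a vertex function over the two endpoints of an unordered pair. -/
def ssum (f : V → ℝ) : Sym2 V → ℝ :=
  Sym2.lift ⟨fun i j => f i + f j, fun i j => add_comm _ _⟩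

/-- Quenched transition probability `p_{ij}(w) = w_{ij}/w_i`. -/
def qstep (G : SimpleGraph V) [DecidableRel G.Adj] (w : Sym2 V → ℝ) (i j : V) : ℝ :=
  if G.Adj i j then w s(i, j) / vw G w i else 0

/-- Stationary distribution `π_i(w) = w_i / Σ_v w_v` of the quenched chain. -/
def statDist (G : SimpleGraph V) [DecidableRel G.Adj] (w : Sym2 V → ℝ) (i : V) : ℝ :=
  vw G w i / ∑ v : V, vw G w v

/-- Spanning trees of `G`, as edge sets. -/
def spanningTrees (G : SimpleGraph V) [DecidableRel G.Adj] : Finset (Finset (Sym2 V)) :=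
  G.edgeFinset.powerset.filter fun F =>
    (SimpleGraph.fromEdgeSet (F : Set (Sym2 V))).IsTree

/-- Spanning-tree polynomial `τ(w) = Σ_{T} Π_{e ∈ T} w_e`. -/
def tau (G : SimpleGraph V) [DecidableRel G.Adj] (w : Sym2 V → ℝ) : ℝ :=
  ∑ F ∈ spanningTrees G, ∏ e ∈ F, w e

/-- Vertex parameter `b_v = (B_v + 1 - 𝟙(v = x))/2`. -/
def bwt (G : SimpleGraph V) [DecidableRel G.Adj] (x : V) (B : Sym2 V → ℝ) (v : V) : ℝ :=
  (vw G B v + 1 - if v = x then 1 else 0) / 2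

/-- The normalizing constant `Z_{x,B}` of the magic formula. -/
def Znorm (G : SimpleGraph V) [DecidableRel G.Adj] (x : V) (B : Sym2 V → ℝ) : ℝ :=
  ((∏ e ∈ G.edgeFinset, Real.Gamma (B e)) /
      ∏ v : V, Real.Gamma (bwt G x B v)) *
    Real.pi ^ (((Fintype.card V : ℝ) - 1) / 2) /
    2 ^ ((1 : ℝ) - (Fintype.card V : ℝ) + ∑ e ∈ G.edgeFinset, B e)

/-- The magic-formula density of `μ_{x,B}` with respect to `Π_{e ≠ e0} dw_e`. -/
def magicDensity (G : SimpleGraph V) [DecidableRel G.Adj] (x : V) (B : Sym2 V → ℝ)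
    (w : Sym2 V → ℝ) : ℝ :=
  (Znorm G x B)⁻¹ * (vw G w x) ^ ((1 : ℝ) / 2) *
      (∏ e ∈ G.edgeFinset, w e ^ (B e - 1)) /
      (∏ v : V, (vw G w v) ^ ((vw G B v + 1) / 2)) *
    Real.sqrt (tau G w)

/-- Coordinates indexed by the non-reference edges. -/
abbrev Epin (G : SimpleGraph V) [DecidableRel G.Adj] (e0 : Sym2 V) :=
  {e : Sym2 V // e ∈ G.edgeFinset ∧ e ≠ e0}

/-- Extension of non-reference edge coordinates to a pinned environment (`w_{e0} = 1`). -/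
def pinExt (G : SimpleGraph V) [DecidableRel G.Adj] (e0 : Sym2 V)
    (u : Epin G e0 → ℝ) : Sym2 V → ℝ :=
  fun e => if e = e0 then 1 else if h : e ∈ G.edgeFinset ∧ e ≠ e0 then u ⟨e, h⟩ else 0

/-- The mixing measure `μ_{x,B}` of the magic formula, as a measure on
environments pinned at the reference edge `e0`. -/
def mixing (G : SimpleGraph V) [DecidableRel G.Adj] (e0 : Sym2 V) (x : V) (B : Sym2 V → ℝ) :
    Measure (Sym2 V → ℝ) :=
  Measure.map (pinExt G e0)
    ((volume : Measure (Epin G e0 → ℝ)).withDensity fun u =>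
      ENNReal.ofReal
        (if ∀ e ∈ G.edgeFinset, 0 < pinExt G e0 u e then
          magicDensity G x B (pinExt G e0 u) else 0))

/-- Kullback–Leibler divergence (natural logarithm), `+∞` if `P` is not
absolutely continuous with respect to `Q`. -/
def KL {Ω : Type*} [MeasurableSpace Ω] (P Q : Measure Ω) : EReal :=
  if P ≪ Q then ((∫ x, Real.log (P.rnDeriv Q x).toReal ∂P : ℝ) : EReal) else ⊤

/-- Edge local time (current edge weight) at time `t` along a path. -/
def localTime (a : Sym2 V → ℝ) (x : ℕ → V) (t : ℕ) (e : Sym2 V) : ℝ :=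
  a e + ((Finset.range t).filter fun k => s(x k, x (k + 1)) = e).card

/-- One-step ERRW conditional probability at time `t` given the past of the path. -/
def errwStep (G : SimpleGraph V) [DecidableRel G.Adj] (a : Sym2 V → ℝ) (x : ℕ → V)
    (t : ℕ) : ℝ :=
  if G.Adj (x t) (x (t + 1)) then
    localTime a x t s(x t, x (t + 1)) /
      ∑ u ∈ G.neighborFinset (x t), localTime a x t s(x t, u)
  else 0

/-- Extension of a finite path to ℕ (junk value `v0` beyond time `T`). -/
def extendPath {T : ℕ} (v0 : V) (x : Fin (T + 1) → V) : ℕ → V :=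
  fun t => if h : t < T + 1 then x ⟨t, h⟩ else v0

/-- ERRW trajectory probability of a length-`T` path (the trajectory law mass function). -/
def errwProb (G : SimpleGraph V) [DecidableRel G.Adj] (v0 : V) (a : Sym2 V → ℝ) (T : ℕ)
    (x : Fin (T + 1) → V) : ℝ :=
  if x 0 = v0 then ∏ t ∈ Finset.range T, errwStep G a (extendPath v0 x) t else 0

/-- Undirected traversal count `N_e` of an edge along a finite path. -/
def edgeCount {T : ℕ} (v0 : V) (x : Fin (T + 1) → V) (e : Sym2 V) : ℕ :=
  ((Finset.range T).filter fun k =>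
    s(extendPath v0 x k, extendPath v0 x (k + 1)) = e).card

/-- Quenched path probability of a length-`T` path started at `v0`. -/
def quenchedProb (G : SimpleGraph V) [DecidableRel G.Adj] (v0 : V) (w : Sym2 V → ℝ) (T : ℕ)
    (x : Fin (T + 1) → V) : ℝ :=
  if x 0 = v0 then
    ∏ t ∈ Finset.range T, qstep G w (extendPath v0 x t) (extendPath v0 x (t + 1))
  else 0

/-- The measure on a finite type determined by a mass function. -/
def discreteMeasure {Ω : Type*} [Fintype Ω] [MeasurableSpace Ω] (p : Ω → ℝ) : Measure Ω :=
  ∑ x : Ω, ENNReal.ofReal (p x) • Measure.dirac x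

/-- Digamma function `Ψ = (log Γ)'`. -/
def digamma (x : ℝ) : ℝ := deriv (fun y => Real.log (Real.Gamma y)) x

/-- Trigamma function `Ψ₁ = Ψ'`. -/
def trigamma (x : ℝ) : ℝ := deriv digamma x

/-- `Λ(p,q) = log Γ(q) − log Γ(p) − (q−p)·Ψ(p)`. -/
def Lam (p q : ℝ) : ℝ :=
  Real.log (Real.Gamma q) - Real.log (Real.Gamma p) - (q - p) * digamma p

/-- The weight at a vertex, as a sum over the edges containing it. -/
theorem vw_eq_sum_edgeFinset (G : SimpleGraph V) [DecidableRel G.Adj] (w : Sym2 V → ℝ) (i : V) :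
    vw G w i = ∑ e ∈ G.edgeFinset with i ∈ e, w e := by
  refine Finset.sum_bij (fun j _ => s(i, j)) ?_ ?_ ?_ ?_
  · intro j hj
    simpa using hj
  · intro j _ k _ h
    exact Sym2.congr_right.mp h
  · intro e he
    obtain ⟨he, j, rfl⟩ := Finset.mem_filter.mp he
    exact ⟨j, by simpa using he, rfl⟩
  · intros
    rfl

/-- Isolated vertices together with one further vertex lie in distinct components. -/
theorem card_add_one_le_card_connectedComponent (H : SimpleGraph V) (S : Finset V)
    (hS : ∀ v ∈ S, ∀ w, ¬ H.Adj v w) {u : V} (hu : u ∉ S) :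
    S.card + 1 ≤ Nat.card H.ConnectedComponent := by
  have hreach : ∀ v ∈ S, ∀ w, H.Reachable v w → v = w := by
    rintro v hv w ⟨p⟩
    cases p with
    | nil => rfl
    | cons h _ => exact (hS v hv _ h).elim
  have hinj : Set.InjOn H.connectedComponentMk (insert u S : Finset V) := by
    intro v hv w hw h
    have h' : H.Reachable v w := SimpleGraph.ConnectedComponent.exact h
    rcases Finset.mem_insert.mp hv with rfl | hv
    · rcases Finset.mem_insert.mp hw with rfl | hw
      · rfl
      · exact (hreach w hw v h'.symm).symm
    · exact hreach v hv w h'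
  rw [← Finset.card_insert_of_notMem hu, ← Finset.card_image_of_injOn hinj,
    Nat.card_eq_fintype_card]
  exact Finset.card_le_univ _

/-- A nonempty proper vertex set of a connected graph has an edge leaving it. -/
theorem exists_adj_mem_notMem {W : Type*} {G : SimpleGraph W} (hG : G.Connected)
    {S : Finset W} {v u : W} (hv : v ∈ S) (hu : u ∉ S) : ∃ x ∈ S, ∃ y ∉ S, G.Adj x y := by
  obtain ⟨p⟩ := hG.preconnected v u
  obtain ⟨d, -, hd, hd'⟩ := p.exists_boundary_dart (S : Set W) hv hu
  exact ⟨d.fst, hd, d.snd, hd', d.adj⟩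

/-- At most two vertices lie on an unordered pair. -/
theorem card_filter_mem_le_two {W : Type*} [DecidableEq W] (S : Finset W) (e : Sym2 W) :
    {v ∈ S | v ∈ e}.card ≤ 2 := by
  induction e with
  | _ x y =>
    refine (Finset.card_le_card (t := {x, y}) fun v hv => ?_).trans Finset.card_le_two
    simpa using (Finset.mem_filter.mp hv).2

/-- At most one vertex of `S` lies on an unordered pair with an endpoint outside `S`. -/
theorem card_filter_mem_le_one {W : Type*} [DecidableEq W] {S : Finset W} {y : W} (hy : y ∉ S)
    (x : W) :
    {v ∈ S | v ∈ s(x, y)}.card ≤ 1 := by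
  refine (Finset.card_le_card (t := {x}) fun v hv => ?_).trans (Finset.card_singleton x).le
  obtain ⟨hvS, hv⟩ := Finset.mem_filter.mp hv
  rcases Sym2.mem_iff.mp hv with rfl | rfl
  · simp
  · exact (hy hvS).elim

/-- Combinatorial lower bound `A(F) ≥ ā/2`.  If `a_g ≥ ā > 0` for all
edges, then for every nonempty proper subset `F ⊊ E`, with
`S(F)` the set of vertices all of whose incident edges lie in `F` and
`κ(G∖F)` the number of connected components of `(V, E∖F)`,
`A(F) = a(F) − Σ_{v∈S(F)} b_v + (κ(G∖F) − 1)/2 ≥ ā/2`. -/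
theorem A_of_F_lower_bound
    {V : Type*} [Fintype V] [DecidableEq V]
    (G : SimpleGraph V) [DecidableRel G.Adj] (hG : G.Connected)
    (v0 : V) (a : Sym2 V → ℝ)
    (abar : ℝ) (habar : 0 < abar) (ha : ∀ g ∈ G.edgeFinset, abar ≤ a g)
    (F : Finset (Sym2 V)) (hFsub : F ⊆ G.edgeFinset) (hFne : F.Nonempty)
    (hFprop : F ≠ G.edgeFinset) :
    (∑ g ∈ F, a g)
        - (∑ v ∈ Finset.univ.filter (fun v : V => ∀ e ∈ G.edgeFinset, v ∈ e → e ∈ F),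
            bwt G v0 a v)
        + (((Nat.card
              (SimpleGraph.fromEdgeSet
                ((↑(G.edgeFinset \ F) : Set (Sym2 V)))).ConnectedComponent : ℝ) - 1) / 2)
      ≥ abar / 2 := by
  set S := Finset.univ.filter (fun v : V => ∀ e ∈ G.edgeFinset, v ∈ e → e ∈ F) with hSdef
  have memS {v : V} : v ∈ S ↔ ∀ e ∈ G.edgeFinset, v ∈ e → e ∈ F := by simp [hSdef]
  obtain ⟨u, hu⟩ : ∃ u, u ∉ S := by
    obtain ⟨e, he, heF⟩ := Finset.exists_of_ssubset (hFsub.ssubset_of_ne hFprop)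
    induction e with
    | _ x y => exact ⟨x, fun hx => heF (memS.mp hx _ he (Sym2.mem_mk_left x y))⟩
  have hκ : (S.card : ℝ) + 1 ≤ Nat.card (SimpleGraph.fromEdgeSet
      ((↑(G.edgeFinset \ F) : Set (Sym2 V)))).ConnectedComponent := by
    exact_mod_cast card_add_one_le_card_connectedComponent _ S (fun v hv w hvw => by
      obtain ⟨he, heF⟩ := Finset.mem_sdiff.mp (Finset.mem_coe.mp
        ((SimpleGraph.fromEdgeSet_adj _).mp hvw).1)
      exact heF (memS.mp hv _ he (Sym2.mem_mk_left v w))) hu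
  have hvw : ∑ v ∈ S, vw G a v = ∑ e ∈ F, {v ∈ S | v ∈ e}.card * a e := by
    calc ∑ v ∈ S, vw G a v = ∑ v ∈ S, ∑ e ∈ G.edgeFinset with v ∈ e, a e :=
          Finset.sum_congr rfl fun v _ => vw_eq_sum_edgeFinset G a v
      _ = ∑ e ∈ F, ∑ v ∈ S with v ∈ e, a e := by
          refine Finset.sum_comm' fun v e => ?_
          simp only [Finset.mem_filter]
          exact ⟨fun ⟨hv, he, hve⟩ => ⟨⟨hv, hve⟩, memS.mp hv e he hve⟩,
            fun ⟨⟨hv, hve⟩, he⟩ => ⟨hv, hFsub he, hve⟩⟩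
      _ = _ := by simp
  have hb : ∑ v ∈ S, bwt G v0 a v ≤ (∑ v ∈ S, vw G a v + S.card) / 2 := by
    calc ∑ v ∈ S, bwt G v0 a v ≤ ∑ v ∈ S, (vw G a v + 1) / 2 := by
          refine Finset.sum_le_sum fun v _ => ?_
          unfold bwt
          split_ifs <;> linarith
      _ = _ := by simp [← Finset.sum_div, Finset.sum_add_distrib]
  obtain ⟨e₀, he₀, hcard⟩ : ∃ e ∈ F, {v ∈ S | v ∈ e}.card ≤ 1 := by
    rcases S.eq_empty_or_nonempty with hS | ⟨v, hv⟩
    · obtain ⟨e, he⟩ := hFne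
      exact ⟨e, he, by simp [hS]⟩
    · obtain ⟨x, hx, y, hy, hxy⟩ := exists_adj_mem_notMem hG hv hu
      exact ⟨s(x, y), memS.mp hx _ (by simpa using hxy) (Sym2.mem_mk_left x y),
        card_filter_mem_le_one hy x⟩
  have hedge : abar / 2 ≤ ∑ e ∈ F, (a e - {v ∈ S | v ∈ e}.card * a e / 2) := by
    have hnonneg : ∀ e ∈ F, 0 ≤ a e - {v ∈ S | v ∈ e}.card * a e / 2 := fun e he => by
      have h2 : ({v ∈ S | v ∈ e}.card : ℝ) ≤ 2 := by
        exact_mod_cast card_filter_mem_le_two S e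
      nlinarith [ha e (hFsub he)]
    have h1 : ({v ∈ S | v ∈ e₀}.card : ℝ) ≤ 1 := by exact_mod_cast hcard
    refine le_trans ?_ (Finset.single_le_sum hnonneg he₀)
    nlinarith [ha e₀ (hFsub he₀)]
  rw [Finset.sum_sub_distrib, ← Finset.sum_div, ← hvw] at hedge
  linarith

end ERRW
end
end

section
/- Suppose a_g ≥ ā > 0 for all g ∈ E, and fix an edge e ∈ E and a real number s with 0 < s < ā/2. Let W ∼ μ_{v0,A} and set X_e := W_e / Σ_{g∈E} W_g. Then E[X_e^{−s}] < ∞, and, setting C_{e,s} := E[X_e^{−s}], one has P(X_e < ε) ≤ C_{e,s} · ε^s for every 0 < ε < 1. -/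
open MeasureTheory Real Filter
open scoped ENNReal NNReal Classical BigOperators

noncomputable section

namespace ERRW

variable {V : Type*} [Fintype V] [DecidableEq V]

/-- Product of the quenched transition probabilities out of a vertex. -/
def stepProd (G : SimpleGraph V) [DecidableRel G.Adj] (w : Sym2 V → ℝ) (v : V) : ℝ :=
  ∏ j ∈ G.neighborFinset v, w s(v, j) / vw G w v

section Weights

variable {G : SimpleGraph V} [DecidableRel G.Adj] {w : Sym2 V → ℝ}

lemma le_vw (hw : ∀ e ∈ G.edgeFinset, 0 < w e) {i j : V} (h : G.Adj i j) :
    w s(i, j) ≤ vw G w i := by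
  refine Finset.single_le_sum (f := fun j => w s(i, j)) (fun k hk => (hw _ ?_).le) ?_
  · simpa using hk
  · simpa using h

lemma vw_pos (hw : ∀ e ∈ G.edgeFinset, 0 < w e) {i j : V} (h : G.Adj i j) :
    0 < vw G w i :=
  (hw s(i, j) (by simpa using h)).trans_le (le_vw hw h)

lemma ratio_pos (hw : ∀ e ∈ G.edgeFinset, 0 < w e) {i j : V} (h : G.Adj i j) :
    0 < w s(i, j) / vw G w i :=
  div_pos (hw s(i, j) (by simpa using h)) (vw_pos hw h)

lemma ratio_le_one (hw : ∀ e ∈ G.edgeFinset, 0 < w e) {i j : V} (h : G.Adj i j) :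
    w s(i, j) / vw G w i ≤ 1 :=
  div_le_one_of_le₀ (le_vw hw h) (vw_pos hw h).le

lemma stepProd_pos (hw : ∀ e ∈ G.edgeFinset, 0 < w e) (v : V) : 0 < stepProd G w v :=
  Finset.prod_pos fun j hj => ratio_pos hw (by simpa using hj)

lemma stepProd_le_one (hw : ∀ e ∈ G.edgeFinset, 0 < w e) (v : V) : stepProd G w v ≤ 1 :=
  Finset.prod_le_one (fun j hj => (ratio_pos hw (by simpa using hj)).le)
    fun j hj => ratio_le_one hw (by simpa using hj)

lemma stepProd_le (hw : ∀ e ∈ G.edgeFinset, 0 < w e) {v j : V} (h : G.Adj v j) :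
    stepProd G w v ≤ w s(v, j) / vw G w v := by
  have hj : j ∈ G.neighborFinset v := by simpa using h
  rw [stepProd, ← Finset.mul_prod_erase _ _ hj]
  refine mul_le_of_le_one_right (ratio_pos hw h).le (Finset.prod_le_one ?_ ?_)
  · intro k hk
    exact (ratio_pos hw (by simpa using Finset.mem_of_mem_erase hk)).le
  · intro k hk
    exact ratio_le_one hw (by simpa using Finset.mem_of_mem_erase hk)

lemma prod_support_stepProd_le (hw : ∀ e ∈ G.edgeFinset, 0 < w e) {x y z : V}
    (p : G.Walk x y) (h : G.Adj y z) :
    (p.support.map (stepProd G w)).prod ≤ w s(y, z) / vw G w x := by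
  induction p with
  | nil => simpa using stepProd_le hw h
  | @cons x x' y hx p ih =>
    have hyz : 0 < w s(y, z) := hw _ (by simpa using h)
    have hxx : 0 < w s(x, x') := hw _ (by simpa using hx)
    have hx0 := vw_pos hw hx
    have hx1 : w s(x, x') ≤ vw G w x' := by
      rw [Sym2.eq_swap]; exact le_vw hw hx.symm
    have hx1' := hxx.trans_le hx1
    rw [SimpleGraph.Walk.support_cons, List.map_cons, List.prod_cons]
    calc stepProd G w x * (p.support.map (stepProd G w)).prod
        ≤ (w s(x, x') / vw G w x) * (w s(y, z) / vw G w x') :=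
          mul_le_mul (stepProd_le hw hx) (ih h)
            (List.prod_nonneg fun a ha => by
              obtain ⟨v, -, rfl⟩ := List.mem_map.1 ha
              exact (stepProd_pos hw v).le) (ratio_pos hw hx).le
      _ = (w s(x, x') / vw G w x') * (w s(y, z) / vw G w x) := by ring
      _ ≤ w s(y, z) / vw G w x :=
          mul_le_of_le_one_left (by positivity) (div_le_one_of_le₀ hx1 hx1'.le)

/-- The product of all transition probabilities is at most the ratio of any edge weight to any
vertex weight. -/
lemma prod_stepProd_le (hG : G.Connected) (hw : ∀ e ∈ G.edgeFinset, 0 < w e)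
    {f : Sym2 V} (hf : f ∈ G.edgeFinset) (x : V) :
    ∏ v, stepProd G w v ≤ w f / vw G w x := by
  induction f with
  | _ y z =>
    have h : G.Adj y z := by simpa using hf
    obtain ⟨p, hp⟩ := (hG x y).exists_isPath
    refine le_trans ?_ (prod_support_stepProd_le hw p h)
    rw [← List.prod_toFinset _ hp.support_nodup]
    rw [← Finset.prod_sdiff (Finset.subset_univ p.support.toFinset)]
    exact mul_le_of_le_one_left (Finset.prod_nonneg fun v _ => (stepProd_pos hw v).le)
      (Finset.prod_le_one (fun v _ => (stepProd_pos hw v).le) fun v _ => stepProd_le_one hw v)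

lemma prod_neighbor_eq_prod_edge_sq (h : Sym2 V → ℝ) :
    ∏ v, ∏ j ∈ G.neighborFinset v, h s(v, j) = ∏ e ∈ G.edgeFinset, h e ^ 2 := by
  have h1 : ∏ d : G.Dart, h d.edge = ∏ e ∈ G.edgeFinset, h e ^ 2 := by
    rw [← Finset.prod_fiberwise_of_maps_to (s := Finset.univ) (t := G.edgeFinset)
      (g := fun d : G.Dart => d.edge) (by simp [SimpleGraph.Dart.edge_mem])]
    refine Finset.prod_congr rfl fun e he => ?_
    rw [← G.dart_edge_fiber_card e (by simpa using he), ← Finset.prod_const]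
    refine Finset.prod_congr (by ext; simp) fun d hd => ?_
    rw [(Finset.mem_filter.1 hd).2]
  have h2 : ∏ d : G.Dart, h d.edge = ∏ v, ∏ j ∈ G.neighborFinset v, h s(v, j) := by
    rw [← Finset.prod_fiberwise (s := Finset.univ) (g := fun d : G.Dart => d.fst)]
    refine Finset.prod_congr rfl fun v _ => ?_
    refine Finset.prod_bij' (fun d _ => d.snd)
      (fun j hj => ⟨(v, j), by simpa using hj⟩) ?_ ?_ ?_ ?_ ?_
    · rintro ⟨⟨a, b⟩, hd⟩ h'
      obtain rfl : a = v := by simpa using h'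
      simpa using hd
    · simp
    · rintro ⟨⟨a, b⟩, hd⟩ h'
      obtain rfl : a = v := by simpa using h'
      rfl
    · simp
    · rintro ⟨⟨a, b⟩, hd⟩ h'
      obtain rfl : a = v := by simpa using h'
      rfl
  rw [← h1, h2]

lemma prod_spanningTree_le (hw : ∀ e ∈ G.edgeFinset, 0 < w e) (x : V)
    {F : Finset (Sym2 V)} (hF : F ∈ spanningTrees G) :
    ∏ e ∈ F, w e ≤ ∏ v ∈ Finset.univ.erase x, vw G w v := by
  obtain ⟨hFG, hT⟩ := Finset.mem_filter.1 hF
  rw [Finset.mem_powerset] at hFG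
  set T := SimpleGraph.fromEdgeSet (F : Set (Sym2 V)) with hTdef
  have hTF : ∀ {i j}, T.Adj i j → s(i, j) ∈ F := fun h => by
    simpa using ((SimpleGraph.fromEdgeSet_adj _).1 h).1
  have hedge : T.edgeFinset = F := by
    ext e
    rw [SimpleGraph.mem_edgeFinset, SimpleGraph.edgeSet_fromEdgeSet]
    refine ⟨fun h => h.1, fun h => ⟨h, ?_⟩⟩
    exact G.not_isDiag_of_mem_edgeFinset (hFG h)
  have hcard : F.card + 1 = Fintype.card V := by
    rw [← hedge]; exact hT.card_edgeFinset
  have hpar : ∀ v, ∃ u, v ≠ x → T.Adj v u ∧ T.dist u x < T.dist v x := by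
    intro v
    by_cases hv : v = x
    · exact ⟨v, fun h => absurd hv h⟩
    obtain ⟨p, hp⟩ := hT.connected.exists_walk_length_eq_dist v x
    cases p with
    | nil => exact absurd rfl hv
    | @cons _ u _ h p =>
      refine ⟨u, fun _ => ⟨h, ?_⟩⟩
      rw [← hp, SimpleGraph.Walk.length_cons]
      exact Nat.lt_succ_of_le (SimpleGraph.dist_le p)
  choose par hpar using hpar
  have hinj : Set.InjOn (fun v => s(v, par v)) (Finset.univ.erase x : Finset V) := by
    intro u hu v hv huv
    have hu' := hpar u (by simpa using hu)
    have hv' := hpar v (by simpa using hv)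
    rcases Sym2.eq_iff.1 huv with ⟨h, -⟩ | ⟨h1, h2⟩
    · exact h
    · rw [h2] at hu'
      rw [← h1] at hv'
      exact absurd hu'.2 hv'.2.not_gt
  have himg : (Finset.univ.erase x).image (fun v => s(v, par v)) = F := by
    refine Finset.eq_of_subset_of_card_le ?_ ?_
    · intro e he
      obtain ⟨v, hv, rfl⟩ := Finset.mem_image.1 he
      exact hTF (hpar v (by simpa using hv)).1
    · rw [Finset.card_image_of_injOn hinj, Finset.card_erase_of_mem (Finset.mem_univ _),
        Finset.card_univ]
      omega
  rw [← himg, Finset.prod_image hinj]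
  refine Finset.prod_le_prod (fun v hv => ?_) fun v hv => ?_
  · exact (hw _ (hFG (hTF (hpar v (by simpa using hv)).1))).le
  · have := hFG (hTF (hpar v (by simpa using hv)).1)
    exact le_vw hw (by simpa using this)

lemma tau_le (hw : ∀ e ∈ G.edgeFinset, 0 < w e) (x : V) :
    tau G w ≤ (spanningTrees G).card * ∏ v ∈ Finset.univ.erase x, vw G w v := by
  rw [tau, ← nsmul_eq_mul]
  exact Finset.sum_le_card_nsmul _ _ _ fun F hF => prod_spanningTree_le hw x hF

lemma vw_pos_of_connected (hG : G.Connected) {e0 : Sym2 V} (he0 : e0 ∈ G.edgeFinset)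
    (hw : ∀ e ∈ G.edgeFinset, 0 < w e) (v : V) : 0 < vw G w v := by
  induction e0 with
  | _ y z =>
    have h : G.Adj y z := by simpa using he0
    have : Nontrivial V := ⟨y, z, h.ne⟩
    obtain ⟨u, hu⟩ := hG.preconnected.exists_adj_of_nontrivial v
    exact vw_pos hw hu

lemma prod_rpow_div_le (hw : ∀ e ∈ G.edgeFinset, 0 < w e) (hv : ∀ v, 0 < vw G w v)
    {B : Sym2 V → ℝ} {b : ℝ} (hB : ∀ e ∈ G.edgeFinset, b ≤ B e) :
    (∏ e ∈ G.edgeFinset, w e ^ B e) / ∏ v, vw G w v ^ (vw G B v / 2) ≤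
      (∏ v, stepProd G w v) ^ (b / 2) := by
  have hadj : ∀ {v j}, j ∈ G.neighborFinset v → G.Adj v j := fun h => by simpa using h
  have h1 : ∏ e ∈ G.edgeFinset, w e ^ B e =
      ∏ v, ∏ j ∈ G.neighborFinset v, w s(v, j) ^ (B s(v, j) / 2) := by
    rw [prod_neighbor_eq_prod_edge_sq (fun e => w e ^ (B e / 2))]
    refine Finset.prod_congr rfl fun e he => ?_
    rw [← Real.rpow_mul_natCast (hw e he).le]
    congr 1
    push_cast
    ring
  have h2 : ∏ v, vw G w v ^ (vw G B v / 2) =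
      ∏ v, ∏ j ∈ G.neighborFinset v, vw G w v ^ (B s(v, j) / 2) := by
    refine Finset.prod_congr rfl fun v _ => ?_
    rw [← Real.rpow_sum_of_pos (hv v), ← Finset.sum_div, vw, vw]
  rw [h1, h2, ← Finset.prod_div_distrib,
    ← Real.finsetProd_rpow _ _ fun v _ => (stepProd_pos hw v).le]
  refine Finset.prod_le_prod (fun v _ => ?_) fun v _ => ?_
  · rw [← Finset.prod_div_distrib]
    exact Finset.prod_nonneg fun j hj => div_nonneg
      (Real.rpow_nonneg (hw _ (by simpa using hj)).le _) (Real.rpow_nonneg (hv v).le _)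
  · rw [← Finset.prod_div_distrib, stepProd,
      ← Real.finsetProd_rpow _ _ fun j hj => (ratio_pos hw (hadj hj)).le]
    refine Finset.prod_le_prod (fun j hj => ?_) fun j hj => ?_
    · exact div_nonneg (Real.rpow_nonneg (hw _ (by simpa using hj)).le _)
        (Real.rpow_nonneg (hv v).le _)
    · rw [← Real.div_rpow (hw _ (by simpa using hj)).le (hv v).le]
      refine Real.rpow_le_rpow_of_exponent_ge (ratio_pos hw (hadj hj))
        (ratio_le_one hw (hadj hj)) ?_
      have := hB s(v, j) (by simpa using hj)
      linarith

lemma sqrt_tau_mul_le (hw : ∀ e ∈ G.edgeFinset, 0 < w e) (hv : ∀ v, 0 < vw G w v) (x : V) :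
    vw G w x ^ ((1 : ℝ) / 2) * √(tau G w) ≤
      √((spanningTrees G).card) * ∏ v, vw G w v ^ ((1 : ℝ) / 2) := by
  have h : √(tau G w) ≤ √((spanningTrees G).card) *
      ∏ v ∈ Finset.univ.erase x, vw G w v ^ ((1 : ℝ) / 2) := by
    rw [Real.finsetProd_rpow _ _ fun v _ => (hv v).le, ← Real.sqrt_eq_rpow,
      ← Real.sqrt_mul (Nat.cast_nonneg _)]
    exact Real.sqrt_le_sqrt (tau_le hw x)
  rw [← Finset.mul_prod_erase _ _ (Finset.mem_univ x)]
  calc _ ≤ _ := mul_le_mul_of_nonneg_left h (Real.rpow_nonneg (hv x).le _)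
    _ = _ := by ring

lemma magicDensity_le (hw : ∀ e ∈ G.edgeFinset, 0 < w e) (hv : ∀ v, 0 < vw G w v) (x : V)
    {B : Sym2 V → ℝ} {b : ℝ} (hB : ∀ e ∈ G.edgeFinset, b ≤ B e) :
    magicDensity G x B w ≤ |(Znorm G x B)⁻¹| * √((spanningTrees G).card) *
      ((∏ v, stepProd G w v) ^ (b / 2) * ∏ e ∈ G.edgeFinset, (w e)⁻¹) := by
  have h1 : ∏ e ∈ G.edgeFinset, w e ^ (B e - 1) =
      (∏ e ∈ G.edgeFinset, w e ^ B e) * ∏ e ∈ G.edgeFinset, (w e)⁻¹ := by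
    rw [← Finset.prod_mul_distrib]
    refine Finset.prod_congr rfl fun e he => ?_
    rw [Real.rpow_sub_one (hw e he).ne', div_eq_mul_inv]
  have h2 : ∏ v, vw G w v ^ ((vw G B v + 1) / 2) =
      (∏ v, vw G w v ^ (vw G B v / 2)) * ∏ v, vw G w v ^ ((1 : ℝ) / 2) := by
    rw [← Finset.prod_mul_distrib]
    refine Finset.prod_congr rfl fun v _ => ?_
    rw [← Real.rpow_add (hv v), add_div]
  have hD : 0 < ∏ v, vw G w v ^ ((1 : ℝ) / 2) :=
    Finset.prod_pos fun v _ => Real.rpow_pos_of_pos (hv v) _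
  have hI : 0 < ∏ e ∈ G.edgeFinset, (w e)⁻¹ :=
    Finset.prod_pos fun e he => inv_pos.2 (hw e he)
  have hQ : 0 ≤ (∏ e ∈ G.edgeFinset, w e ^ B e) / ∏ v, vw G w v ^ (vw G B v / 2) :=
    div_nonneg (Finset.prod_nonneg fun e he => Real.rpow_nonneg (hw e he).le _)
      (Finset.prod_nonneg fun v _ => Real.rpow_nonneg (hv v).le _)
  have hS : vw G w x ^ ((1 : ℝ) / 2) * √(tau G w) / ∏ v, vw G w v ^ ((1 : ℝ) / 2) ≤
      √((spanningTrees G).card) := (div_le_iff₀ hD).2 (sqrt_tau_mul_le hw hv x)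
  have hS0 : 0 ≤ vw G w x ^ ((1 : ℝ) / 2) * √(tau G w) / ∏ v, vw G w v ^ ((1 : ℝ) / 2) :=
    div_nonneg (mul_nonneg (Real.rpow_nonneg (hv x).le _) (Real.sqrt_nonneg _)) hD.le
  calc magicDensity G x B w
      = (Znorm G x B)⁻¹ *
          (vw G w x ^ ((1 : ℝ) / 2) * √(tau G w) / ∏ v, vw G w v ^ ((1 : ℝ) / 2)) *
          (((∏ e ∈ G.edgeFinset, w e ^ B e) / ∏ v, vw G w v ^ (vw G B v / 2)) *
            ∏ e ∈ G.edgeFinset, (w e)⁻¹) := by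
        rw [magicDensity, h1, h2]
        simp only [div_eq_mul_inv, mul_inv]
        ring
    _ ≤ _ := by
        refine mul_le_mul (mul_le_mul (le_abs_self _) hS hS0 (abs_nonneg _))
          (mul_le_mul_of_nonneg_right (prod_rpow_div_le hw hv hB) hI.le)
          (mul_nonneg hQ hI.le) (by positivity)

lemma normalized_rpow_neg_le (hG : G.Connected) (hw : ∀ e ∈ G.edgeFinset, 0 < w e)
    {e : Sym2 V} (he : e ∈ G.edgeFinset) {s : ℝ} (hs : 0 ≤ s) :
    (w e / ∑ g ∈ G.edgeFinset, w g) ^ (-s) ≤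
      (G.edgeFinset.card : ℝ) ^ s * (∏ v, stepProd G w v) ^ (-s) := by
  set P := ∏ v, stepProd G w v with hP
  have hP0 : 0 < P := Finset.prod_pos fun v _ => stepProd_pos hw v
  have hc : 0 < (G.edgeFinset.card : ℝ) := by exact_mod_cast Finset.card_pos.2 ⟨e, he⟩
  have hsum0 : 0 < ∑ g ∈ G.edgeFinset, w g := Finset.sum_pos hw ⟨e, he⟩
  have hsum : ∑ g ∈ G.edgeFinset, w g ≤ G.edgeFinset.card * (w e / P) := by
    rw [← nsmul_eq_mul]
    refine Finset.sum_le_card_nsmul _ _ _ fun g hg => ?_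
    induction g with
    | _ i j =>
      have h : G.Adj i j := by simpa using hg
      refine (le_vw hw h).trans ?_
      have := prod_stepProd_le hG hw he i
      rw [le_div_iff₀ (vw_pos hw h)] at this
      rw [le_div_iff₀ hP0]
      linarith
  have hle : (G.edgeFinset.card : ℝ)⁻¹ * P ≤ w e / ∑ g ∈ G.edgeFinset, w g := by
    rw [le_div_iff₀ hsum0]
    calc _ ≤ (G.edgeFinset.card : ℝ)⁻¹ * P * (G.edgeFinset.card * (w e / P)) :=
          mul_le_mul_of_nonneg_left hsum (by positivity)
      _ = w e := by field_simp
  calc _ ≤ ((G.edgeFinset.card : ℝ)⁻¹ * P) ^ (-s) :=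
        Real.rpow_le_rpow_of_nonpos (by positivity) hle (by linarith)
    _ = _ := by
        rw [Real.mul_rpow (by positivity) hP0.le, Real.inv_rpow hc.le, ← Real.rpow_neg hc.le,
          neg_neg]

end Weights

/-- A one-dimensional integrable majorant: `min(t, 1/t)^η / t` on the positive half-line. -/
def tailMajorant (η t : ℝ) : ℝ := if 0 < t then min t t⁻¹ ^ η * t⁻¹ else 0

lemma tailMajorant_nonneg (η t : ℝ) : 0 ≤ tailMajorant η t := by
  unfold tailMajorant
  split_ifs with h
  · have : 0 < min t t⁻¹ := lt_min h (inv_pos.2 h)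
    positivity
  · exact le_rfl

lemma integrable_tailMajorant {η : ℝ} (hη : 0 < η) : Integrable (tailMajorant η) := by
  have h0 : IntegrableOn (tailMajorant η) (Set.Iic 0) := by
    refine integrableOn_zero.congr_fun (fun t ht => ?_) measurableSet_Iic
    simp [tailMajorant, not_lt.2 (Set.mem_Iic.1 ht)]
  have h1 : IntegrableOn (tailMajorant η) (Set.Ioc 0 1) := by
    have := (intervalIntegrable_iff_integrableOn_Ioc_of_le zero_le_one).1
      (intervalIntegral.intervalIntegrable_rpow' (a := 0) (b := 1) (r := η - 1) (by linarith))
    refine this.congr_fun (fun t ht => ?_) measurableSet_Ioc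
    have h : min t t⁻¹ = t := min_eq_left (ht.2.trans (one_le_inv₀ ht.1 |>.2 ht.2))
    simp only [tailMajorant, if_pos ht.1, h]
    rw [Real.rpow_sub_one ht.1.ne', div_eq_mul_inv]
  have h2 : IntegrableOn (tailMajorant η) (Set.Ioi 1) := by
    have := integrableOn_Ioi_rpow_of_lt (a := -η - 1) (by linarith) zero_lt_one
    refine this.congr_fun (fun t ht => ?_) measurableSet_Ioi
    have ht1 : 1 < t := ht
    have ht0 : 0 < t := zero_lt_one.trans ht1
    have h : min t t⁻¹ = t⁻¹ := min_eq_right ((inv_le_one_of_one_le₀ ht1.le).trans ht1.le)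
    simp only [tailMajorant, if_pos ht0, h]
    rw [Real.rpow_sub_one ht0.ne', Real.inv_rpow ht0.le, Real.rpow_neg ht0.le, div_eq_mul_inv]
  have := (h0.union h1).union h2
  rwa [Set.Iic_union_Ioc_eq_Iic zero_le_one, Set.Iic_union_Ioi, integrableOn_univ] at this

section Pinned

variable {G : SimpleGraph V} [DecidableRel G.Adj] {e0 : Sym2 V}

lemma pinExt_ref (u : Epin G e0 → ℝ) : pinExt G e0 u e0 = 1 := by simp [pinExt]

lemma pinExt_coe (u : Epin G e0 → ℝ) (f : Epin G e0) : pinExt G e0 u f = u f := by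
  simp only [pinExt, if_neg f.2.2, dif_pos f.2]

lemma measurable_pinExt : Measurable (pinExt G e0) := by
  refine measurable_pi_lambda _ fun e => ?_
  unfold pinExt
  split_ifs
  · exact measurable_const
  · exact measurable_pi_apply _
  · exact measurable_const

lemma measurable_magicDensity (x : V) (B : Sym2 V → ℝ) : Measurable (magicDensity G x B) := by
  unfold magicDensity tau vw
  fun_prop

lemma measurable_normalized_weight (e : Sym2 V) :
    Measurable fun w : Sym2 V → ℝ => w e / ∑ g ∈ G.edgeFinset, w g := by
  fun_prop

/-- The density of the mixing measure in the non-reference coordinates. -/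
def pinDensity (G : SimpleGraph V) [DecidableRel G.Adj] (e0 : Sym2 V) (x : V)
    (B : Sym2 V → ℝ) (u : Epin G e0 → ℝ) : ℝ≥0∞ :=
  ENNReal.ofReal (if ∀ e ∈ G.edgeFinset, 0 < pinExt G e0 u e then
    magicDensity G x B (pinExt G e0 u) else 0)

lemma measurable_pinDensity (x : V) (B : Sym2 V → ℝ) : Measurable (pinDensity G e0 x B) := by
  unfold pinDensity
  refine ENNReal.measurable_ofReal.comp (Measurable.ite ?_ ?_ measurable_const)
  · simp only [Set.ofPred_forall]
    exact Finset.measurableSet_biInter _ fun e _ =>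
      measurableSet_lt measurable_const ((measurable_pi_apply e).comp measurable_pinExt)
  · exact (measurable_magicDensity x B).comp measurable_pinExt

lemma mixing_eq (x : V) (B : Sym2 V → ℝ) :
    mixing G e0 x B =
      Measure.map (pinExt G e0) (volume.withDensity (pinDensity G e0 x B)) := rfl

lemma ae_mixing_pos (x : V) (B : Sym2 V → ℝ) :
    ∀ᵐ w ∂mixing G e0 x B, ∀ e ∈ G.edgeFinset, 0 < w e := by
  rw [mixing_eq, ae_map_iff measurable_pinExt.aemeasurable,
    ae_withDensity_iff (measurable_pinDensity x B)]
  · refine ae_of_all _ fun u hu => ?_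
    by_contra h
    exact hu (by rw [pinDensity, if_neg h, ENNReal.ofReal_zero])
  · simp only [Set.ofPred_forall]
    exact Finset.measurableSet_biInter _ fun e _ =>
      measurableSet_lt measurable_const (measurable_pi_apply e)

lemma prod_edge_pinExt (he0 : e0 ∈ G.edgeFinset) (u : Epin G e0 → ℝ) :
    ∏ e ∈ G.edgeFinset, (pinExt G e0 u e)⁻¹ = ∏ f, (u f)⁻¹ := by
  rw [← Finset.mul_prod_erase _ _ he0, pinExt_ref, inv_one, one_mul,
    Finset.prod_subtype (p := fun e => e ∈ G.edgeFinset ∧ e ≠ e0) (G.edgeFinset.erase e0)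
      (fun e => by rw [Finset.mem_erase, and_comm])]
  exact Finset.prod_congr rfl fun f _ => by rw [pinExt_coe]

lemma prod_stepProd_le_min (hG : G.Connected) (he0 : e0 ∈ G.edgeFinset) (u : Epin G e0 → ℝ)
    (hw : ∀ e ∈ G.edgeFinset, 0 < pinExt G e0 u e) (f : Epin G e0) :
    ∏ v, stepProd G (pinExt G e0 u) v ≤ min (u f) (u f)⁻¹ := by
  have key : ∀ g ∈ G.edgeFinset, ∀ h ∈ G.edgeFinset,
      ∏ v, stepProd G (pinExt G e0 u) v ≤ pinExt G e0 u g / pinExt G e0 u h := by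
    intro g hg h hh
    induction h with
    | _ i j =>
      exact (prod_stepProd_le hG hw hg i).trans
        (div_le_div_of_nonneg_left (hw g hg).le (hw _ hh) (le_vw hw (by simpa using hh)))
  refine le_min ?_ ?_
  · simpa [pinExt_ref, pinExt_coe] using key f f.2.1 e0 he0
  · simpa [pinExt_ref, pinExt_coe] using key e0 he0 f f.2.1

lemma prod_stepProd_rpow_mul_le (hG : G.Connected) (he0 : e0 ∈ G.edgeFinset)
    (u : Epin G e0 → ℝ) (hw : ∀ e ∈ G.edgeFinset, 0 < pinExt G e0 u e) {δ : ℝ} (hδ : 0 < δ) :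
    (∏ v, stepProd G (pinExt G e0 u) v) ^ δ * ∏ e ∈ G.edgeFinset, (pinExt G e0 u e)⁻¹ ≤
      ∏ f, tailMajorant (δ / (Fintype.card (Epin G e0) + 1)) (u f) := by
  set P := ∏ v, stepProd G (pinExt G e0 u) v with hP
  set m : ℝ := ((Fintype.card (Epin G e0) : ℕ) : ℝ) with hm
  have hm0 : 0 ≤ m := Nat.cast_nonneg _
  have hP0 : 0 < P := Finset.prod_pos fun v _ => stepProd_pos hw v
  have hP1 : P ≤ 1 := Finset.prod_le_one (fun v _ => (stepProd_pos hw v).le)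
    fun v _ => stepProd_le_one hw v
  have hu : ∀ f, 0 < u f := fun f => pinExt_coe u f ▸ hw f f.2.1
  have h1 : P ^ δ ≤ ∏ _f : Epin G e0, P ^ (δ / (m + 1)) := by
    rw [Finset.prod_const, Finset.card_univ, ← Real.rpow_mul_natCast hP0.le]
    refine Real.rpow_le_rpow_of_exponent_ge hP0 hP1 ?_
    rw [← hm, div_mul_eq_mul_div, div_le_iff₀ (by positivity)]
    nlinarith
  rw [prod_edge_pinExt he0]
  calc _ ≤ (∏ _f : Epin G e0, P ^ (δ / (m + 1))) * ∏ f, (u f)⁻¹ :=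
        mul_le_mul_of_nonneg_right h1 (Finset.prod_nonneg fun f _ => (inv_pos.2 (hu f)).le)
    _ = ∏ f, P ^ (δ / (m + 1)) * (u f)⁻¹ := by rw [Finset.prod_mul_distrib]
    _ ≤ _ := by
        refine Finset.prod_le_prod (fun f _ => ?_) fun f _ => ?_
        · have := hu f
          positivity
        · rw [tailMajorant, if_pos (hu f)]
          refine mul_le_mul_of_nonneg_right ?_ (inv_pos.2 (hu f)).le
          exact Real.rpow_le_rpow hP0.le (prod_stepProd_le_min hG he0 u hw f) (by positivity)

lemma lintegral_normalized_rpow_ne_top (hG : G.Connected) (x : V) (he0 : e0 ∈ G.edgeFinset)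
    {a : Sym2 V → ℝ} {b : ℝ} (ha : ∀ g ∈ G.edgeFinset, b ≤ a g) {e : Sym2 V}
    (he : e ∈ G.edgeFinset) {s : ℝ} (hs0 : 0 < s) (hs : s < b / 2) :
    ∫⁻ w, ENNReal.ofReal ((w e / ∑ g ∈ G.edgeFinset, w g) ^ (-s)) ∂(mixing G e0 x a) ≠ ⊤ := by
  set C : ℝ := (G.edgeFinset.card : ℝ) ^ s *
    (|(Znorm G x a)⁻¹| * √((spanningTrees G).card)) with hC
  have hC0 : 0 ≤ C := by positivity
  set η : ℝ := (b / 2 - s) / (Fintype.card (Epin G e0) + 1) with hη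
  have hη0 : 0 < η := div_pos (by linarith) (by positivity)
  have hint : Integrable (fun u : Epin G e0 → ℝ => C * ∏ f, tailMajorant η (u f)) :=
    (Integrable.fintype_prod fun _ => integrable_tailMajorant hη0).const_mul C
  refine ne_top_of_le_ne_top hint.lintegral_lt_top.ne ?_
  rw [mixing_eq]
  refine (lintegral_map_le _ _).trans
    ((lintegral_withDensity_le_lintegral_mul _ (measurable_pinDensity x a) _).trans
      (lintegral_mono fun u => ?_))
  simp only [Pi.mul_apply, pinDensity]
  split_ifs with hw
  · have hv := vw_pos_of_connected hG he0 hw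
    have hP0 : 0 < ∏ v, stepProd G (pinExt G e0 u) v :=
      Finset.prod_pos fun v _ => stepProd_pos hw v
    have hX0 : 0 ≤ pinExt G e0 u e / ∑ g ∈ G.edgeFinset, pinExt G e0 u g :=
      div_nonneg (hw e he).le (Finset.sum_nonneg fun g hg => (hw g hg).le)
    rw [mul_comm, ← ENNReal.ofReal_mul (Real.rpow_nonneg hX0 _)]
    refine ENNReal.ofReal_le_ofReal ?_
    have hI : 0 < ∏ e ∈ G.edgeFinset, (pinExt G e0 u e)⁻¹ :=
      Finset.prod_pos fun e he => inv_pos.2 (hw e he)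
    calc _ ≤ (pinExt G e0 u e / ∑ g ∈ G.edgeFinset, pinExt G e0 u g) ^ (-s) *
          (|(Znorm G x a)⁻¹| * √((spanningTrees G).card) *
            ((∏ v, stepProd G (pinExt G e0 u) v) ^ (b / 2) *
              ∏ e ∈ G.edgeFinset, (pinExt G e0 u e)⁻¹)) :=
          mul_le_mul_of_nonneg_left (magicDensity_le hw hv x ha) (Real.rpow_nonneg hX0 _)
      _ ≤ (G.edgeFinset.card : ℝ) ^ s * (∏ v, stepProd G (pinExt G e0 u) v) ^ (-s) *
          (|(Znorm G x a)⁻¹| * √((spanningTrees G).card) *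
            ((∏ v, stepProd G (pinExt G e0 u) v) ^ (b / 2) *
              ∏ e ∈ G.edgeFinset, (pinExt G e0 u e)⁻¹)) :=
          mul_le_mul_of_nonneg_right (normalized_rpow_neg_le hG hw he hs0.le) (by positivity)
      _ = C * ((∏ v, stepProd G (pinExt G e0 u) v) ^ (b / 2 - s) *
            ∏ e ∈ G.edgeFinset, (pinExt G e0 u e)⁻¹) := by
          rw [sub_eq_add_neg, Real.rpow_add hP0, hC]
          ring
      _ ≤ _ := mul_le_mul_of_nonneg_left
          (prod_stepProd_rpow_mul_le hG he0 u hw (by linarith)) hC0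
  · simp

end Pinned

/-- Markov's inequality for a negative moment of an almost surely positive variable. -/
lemma measure_lt_le_lintegral_rpow_neg {Ω : Type*} [MeasurableSpace Ω] {μ : Measure Ω}
    {X : Ω → ℝ} (hX : Measurable X) (hpos : ∀ᵐ ω ∂μ, 0 < X ω) {s ε : ℝ} (hs : 0 < s)
    (hε : 0 < ε) :
    μ {ω | X ω < ε} ≤
      (∫⁻ ω, ENNReal.ofReal (X ω ^ (-s)) ∂μ) * ENNReal.ofReal (ε ^ s) := by
  have hm : Measurable fun ω => ENNReal.ofReal (X ω ^ (-s)) := by fun_prop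
  have hle : μ {ω | X ω < ε} ≤
      μ {ω | ENNReal.ofReal (ε ^ (-s)) ≤ ENNReal.ofReal (X ω ^ (-s))} := by
    refine measure_mono_ae ?_
    filter_upwards [hpos] with ω h0 h
    exact ENNReal.ofReal_le_ofReal
      (Real.rpow_le_rpow_of_nonpos h0 (le_of_lt h) (by linarith))
  have hone : ENNReal.ofReal (ε ^ (-s)) * ENNReal.ofReal (ε ^ s) = 1 := by
    rw [← ENNReal.ofReal_mul (Real.rpow_nonneg hε.le _), ← Real.rpow_add hε, neg_add_cancel,
      Real.rpow_zero, ENNReal.ofReal_one]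
  calc μ {ω | X ω < ε}
      = ENNReal.ofReal (ε ^ (-s)) * μ {ω | X ω < ε} * ENNReal.ofReal (ε ^ s) := by
        rw [mul_right_comm, hone, one_mul]
    _ ≤ _ := by
        gcongr
        exact (mul_le_mul_right hle _).trans (mul_meas_ge_le_lintegral hm _)

/-- Small-edge negative moments and tail bound.  If `a_g ≥ ā > 0` on all
edges and `0 < s < ā/2`, then for `W ∼ μ_{v0,A}` and `X_e = W_e/Σ_g W_g` one has
`E[X_e^{−s}] < ∞`, and with `C_{e,s} := E[X_e^{−s}]`,
`P(X_e < ε) ≤ C_{e,s}·ε^s` for all `0 < ε < 1`. -/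
theorem small_edge_tail_bound
    {V : Type*} [Fintype V] [DecidableEq V]
    (G : SimpleGraph V) [DecidableRel G.Adj] (hG : G.Connected)
    (v0 : V) (e0 : Sym2 V) (he0 : e0 ∈ G.edgeFinset)
    (a : Sym2 V → ℝ) (abar : ℝ) (habar : 0 < abar) (ha : ∀ g ∈ G.edgeFinset, abar ≤ a g)
    (e : Sym2 V) (he : e ∈ G.edgeFinset)
    (s : ℝ) (hs0 : 0 < s) (hs : s < abar / 2) :
    (∫⁻ w, ENNReal.ofReal ((w e / ∑ g ∈ G.edgeFinset, w g) ^ (-s)) ∂(mixing G e0 v0 a)) ≠ ⊤ ∧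
    ∀ ε : ℝ, 0 < ε → ε < 1 →
      mixing G e0 v0 a {w | w e / ∑ g ∈ G.edgeFinset, w g < ε}
        ≤ (∫⁻ w, ENNReal.ofReal ((w e / ∑ g ∈ G.edgeFinset, w g) ^ (-s)) ∂(mixing G e0 v0 a))
            * ENNReal.ofReal (ε ^ s) := by
  refine ⟨lintegral_normalized_rpow_ne_top hG v0 he0 ha he hs0 hs, fun ε hε _ => ?_⟩
  refine measure_lt_le_lintegral_rpow_neg (measurable_normalized_weight e) ?_ hs0 hε
  filter_upwards [ae_mixing_pos v0 a] with w hw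
  exact div_pos (hw e he) (Finset.sum_pos hw ⟨e, he⟩)

end ERRW
end
end

section
/- Suppose the initial edge weights satisfy a_g ≥ ā > 0 for all g ∈ E. Fix an edge e ∈ E and γ > 0, and under the ERRW law on (G, v0, A) let N_e(T) := #{1 ≤ t ≤ T : {X_{t−1}, X_t} = e} be the traversal count of e up to time T. (i) If 0 < ā ≤ 4 + 2√5, then for every r with 0 < r < min{ā/8, 3/4} there exists a finite constant C_r, depending only on G, v0, A, e, γ, r, such that E[1/(N_e(T)+γ)] ≤ C_r · T^{−r} for all T ≥ 1. (ii) If ā > 4 + 2√5, then there exists a finite constant C, depending only on G, v0, A, e, γ, such that E[1/(N_e(T)+γ)] ≤ C/T for all T ≥ 1. -/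
open MeasureTheory Real Filter
open scoped ENNReal NNReal Classical BigOperators

noncomputable section

namespace ERRW

variable {V : Type*} [Fintype V] [DecidableEq V]

/-! ### Elementary real estimates -/

/-- The product `∏_{j<k} (1 - s/(α+j)) = Γ(α-s+k) Γ(α) / (Γ(α+k) Γ(α-s))`. -/
def gammaRatio (s α : ℝ) (k : ℕ) : ℝ := ∏ j ∈ Finset.range k, (1 - s / (α + j))

lemma one_sub_div_add_nat_pos {s α : ℝ} (hs : 0 < s) (hα : s < α) (j : ℕ) :
    0 < 1 - s / (α + j) := by
  have hj : (0 : ℝ) ≤ j := j.cast_nonneg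
  rw [sub_pos, div_lt_one (by linarith)]
  linarith

lemma gammaRatio_pos {s α : ℝ} (hs : 0 < s) (hα : s < α) (k : ℕ) : 0 < gammaRatio s α k :=
  Finset.prod_pos fun j _ => one_sub_div_add_nat_pos hs hα j

lemma gammaRatio_succ (s α : ℝ) (k : ℕ) :
    gammaRatio s α (k + 1) = gammaRatio s α k * (1 - s / (α + k)) :=
  Finset.prod_range_succ _ _

lemma gammaRatio_antitone {s α : ℝ} (hs : 0 < s) (hα : s < α) : Antitone (gammaRatio s α) := by
  refine antitone_nat_of_succ_le fun k => ?_
  rw [gammaRatio_succ]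
  refine mul_le_of_le_one_right (gammaRatio_pos hs hα k).le ?_
  have : 0 ≤ s / (α + k) := div_nonneg hs.le (by have := k.cast_nonneg (α := ℝ); linarith)
  linarith

lemma exp_neg_div_sub_le {s x : ℝ} (hx : s < x) (hs : 0 < s) :
    Real.exp (-(s / (x - s))) ≤ 1 - s / x := by
  have h1 : 0 < x - s := by linarith
  have h2 : 0 < x := by linarith
  have h3 : 1 - s / x = (s / (x - s) + 1)⁻¹ := by
    field_simp
    ring
  rw [h3, Real.exp_neg]
  exact inv_anti₀ (by positivity) (Real.add_one_le_exp _)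

lemma rpow_shift_le {s x : ℝ} (hs : 0 < s) (hx : s + 1 < x) :
    (x - s - 1) ^ s ≤ (1 - s / x) * (x - s) ^ s := by
  have h1 : 0 < x - s := by linarith
  have h2 : x - s - 1 ≤ (x - s) * Real.exp (-(1 / (x - s))) := by
    have := Real.add_one_le_exp (-(1 / (x - s)))
    calc x - s - 1 = (x - s) * (-(1 / (x - s)) + 1) := by field_simp; ring
      _ ≤ _ := by gcongr
  calc (x - s - 1) ^ s ≤ ((x - s) * Real.exp (-(1 / (x - s)))) ^ s := by
        gcongr
        linarith
    _ = Real.exp (-(s / (x - s))) * (x - s) ^ s := by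
        rw [Real.mul_rpow h1.le (Real.exp_pos _).le, ← Real.exp_mul, mul_comm]
        congr 2
        ring
    _ ≤ _ := by
        gcongr
        exact exp_neg_div_sub_le (by linarith) hs

lemma exists_mul_rpow_neg_le_gammaRatio {s α : ℝ} (hs : 0 < s) (hα : s < α) :
    ∃ c : ℝ, 0 < c ∧ ∀ k : ℕ, c * (α + k) ^ (-s) ≤ gammaRatio s α k := by
  obtain ⟨K, hK⟩ := exists_nat_ge (s + 2)
  have hα0 : 0 < α := hs.trans hα
  have hKpos := gammaRatio_pos hs hα K
  have tail : ∀ k : ℕ, gammaRatio s α K ≤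
      gammaRatio s α (K + k) * (α + (K + k : ℕ) - s - 1) ^ s := by
    intro k
    induction k with
    | zero =>
      refine le_mul_of_one_le_right hKpos.le (Real.one_le_rpow ?_ hs.le)
      push_cast
      linarith
    | succ k ih =>
      have hk : (0 : ℝ) ≤ k := k.cast_nonneg
      refine ih.trans ?_
      rw [← add_assoc, gammaRatio_succ, mul_assoc]
      refine mul_le_mul_of_nonneg_left ?_ (gammaRatio_pos hs hα _).le
      refine (rpow_shift_le (x := α + (K + k : ℕ)) hs (by push_cast; linarith)).trans_eq ?_
      congr 2
      push_cast
      ring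
  refine ⟨gammaRatio s α K * min 1 (α ^ s), by positivity, fun k => ?_⟩
  have hk : (0 : ℝ) ≤ k := k.cast_nonneg
  have hαk : 0 < α + k := by linarith
  rw [Real.rpow_neg hαk.le, ← div_eq_mul_inv, div_le_iff₀ (by positivity)]
  rcases le_total k K with h | h
  · have h1 : α ^ s ≤ (α + k) ^ s := by gcongr; linarith
    exact mul_le_mul (gammaRatio_antitone hs hα h) ((min_le_right _ _).trans h1)
      (by positivity) (gammaRatio_pos hs hα k).le
  · obtain ⟨l, rfl⟩ := Nat.exists_eq_add_of_le h
    refine (mul_le_of_le_one_right hKpos.le (min_le_left _ _)).trans ((tail l).trans ?_)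
    refine mul_le_mul_of_nonneg_left ?_ (gammaRatio_pos hs hα _).le
    have hl : (0 : ℝ) ≤ l := l.cast_nonneg
    refine Real.rpow_le_rpow ?_ ?_ hs.le
    · push_cast
      linarith
    · linarith

lemma rpow_add_two_le {x d : ℝ} (hd : 0 ≤ d) (hx : d < x) :
    ((x + 2) / x) ^ (d / 2) ≤ x / (x - d) := by
  have hx0 : 0 < x := by linarith
  have h1 : 0 < x - d := by linarith
  have h2 : (x + 2) / x ≤ Real.exp (2 / x) := by
    have := Real.add_one_le_exp (2 / x)
    calc (x + 2) / x = 2 / x + 1 := by field_simp; ring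
      _ ≤ _ := this
  calc ((x + 2) / x) ^ (d / 2) ≤ (Real.exp (2 / x)) ^ (d / 2) := by gcongr
    _ = Real.exp (d / x) := by
        rw [← Real.exp_mul]
        congr 1
        field_simp
    _ ≤ x / (x - d) := by
        have h3 : 1 - d / x ≤ Real.exp (-(d / x)) := by
          have := Real.add_one_le_exp (-(d / x))
          linarith
        have h4 : x / (x - d) = (1 - d / x)⁻¹ := by
          field_simp
        rw [h4, ← inv_inv (Real.exp (d / x)), ← Real.exp_neg]
        refine inv_anti₀ ?_ h3
        rw [sub_pos, div_lt_one hx0]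
        exact hx

lemma single_le_prod_of_one_le {ι : Type*} {S : Finset ι} {f : ι → ℝ} (hf : ∀ i ∈ S, 1 ≤ f i)
    {i : ι} (hi : i ∈ S) : f i ≤ ∏ j ∈ S, f j := by
  rw [← Finset.prod_singleton f i]
  exact Finset.prod_le_prod_of_subset_of_one_le (Finset.singleton_subset_iff.2 hi)
    (fun j hj => by
      rw [Finset.mem_singleton.1 hj]
      exact zero_le_one.trans (hf i hi))
    fun j hj _ => hf j hj

/-! ### Local times along a path -/

/-- Number of traversals of `f` by the path `y` before time `t`. -/
def crossings (y : ℕ → V) (t : ℕ) (f : Sym2 V) : ℕ :=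
  ((Finset.range t).filter fun k => s(y k, y (k + 1)) = f).card

lemma localTime_eq (a : Sym2 V → ℝ) (y : ℕ → V) (t : ℕ) (f : Sym2 V) :
    localTime a y t f = a f + crossings y t f := rfl

lemma crossings_succ (y : ℕ → V) (t : ℕ) (f : Sym2 V) :
    crossings y (t + 1) f = crossings y t f + if f = s(y t, y (t + 1)) then 1 else 0 := by
  unfold crossings
  rw [Finset.range_add_one, Finset.filter_insert]
  by_cases h : f = s(y t, y (t + 1))
  · rw [if_pos h.symm, if_pos h, Finset.card_insert_of_notMem (by simp)]
  · rw [if_neg (Ne.symm h), if_neg h, add_zero]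

lemma le_localTime (a : Sym2 V → ℝ) (y : ℕ → V) (t : ℕ) (f : Sym2 V) :
    a f ≤ localTime a y t f := by
  rw [localTime_eq]
  have := (crossings y t f).cast_nonneg (α := ℝ)
  linarith

lemma localTime_sub (a : Sym2 V → ℝ) (s : ℝ) (y : ℕ → V) (t : ℕ) (f : Sym2 V) :
    localTime (fun g => a g - s) y t f = localTime a y t f - s := by
  simp only [localTime_eq]
  ring

lemma vw_localTime_succ (G : SimpleGraph V) [DecidableRel G.Adj] (a : Sym2 V → ℝ) (y : ℕ → V)
    (t : ℕ) (h : G.Adj (y t) (y (t + 1))) (u : V) :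
    vw G (localTime a y (t + 1)) u = vw G (localTime a y t) u
      + (if u = y t then 1 else 0) + if u = y (t + 1) then 1 else 0 := by
  have key : ∑ j ∈ G.neighborFinset u, (if s(u, j) = s(y t, y (t + 1)) then (1 : ℝ) else 0)
      = (if u = y t then 1 else 0) + if u = y (t + 1) then 1 else 0 := by
    have hne := h.ne
    by_cases h1 : u = y t
    · subst h1
      simp [hne, h]
    · by_cases h2 : u = y (t + 1)
      · have : ∀ j, s(u, j) = s(y t, y (t + 1)) ↔ j = y t := by
          intro j
          rw [h2, Sym2.eq_swap (a := y t)]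
          exact Sym2.congr_right
        simp only [this, Finset.sum_ite_eq']
        simp [h2, h.symm, hne.symm]
      · rw [if_neg h1, if_neg h2, add_zero]
        refine Finset.sum_eq_zero fun j _ => if_neg ?_
        rw [Sym2.eq_iff]
        tauto
  rw [add_assoc, ← key]
  simp only [vw, localTime_eq, crossings_succ, ← Finset.sum_add_distrib]
  refine Finset.sum_congr rfl fun j _ => ?_
  push_cast
  ring

section Comparison

variable (G : SimpleGraph V) [DecidableRel G.Adj]

/-- The total weight at `v`, plus one at every vertex other than the current position. Along a path
it changes only at departures from `v`, and then by two. -/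
def shiftedWeight (a : Sym2 V → ℝ) (y : ℕ → V) (t : ℕ) (v : V) : ℝ :=
  vw G (localTime a y t) v + if v = y t then 0 else 1

/-- Lower bound for the density of the reinforced walk with weights `a - s` relative to the one
with weights `a`. -/
def comparison (a : Sym2 V → ℝ) (s : ℝ) (y : ℕ → V) (t : ℕ) : ℝ :=
  (∏ f ∈ G.edgeFinset, gammaRatio s (a f) (crossings y t f)) *
    ∏ v : V, shiftedWeight G a y t v ^ (G.degree v * s / 2)

variable {G} {a : Sym2 V → ℝ} {s : ℝ}

lemma localTime_pos (hs : 0 ≤ s) (ha : ∀ g ∈ G.edgeFinset, s < a g) (y : ℕ → V) (t : ℕ)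
    {f : Sym2 V} (hf : f ∈ G.edgeFinset) : 0 < localTime a y t f :=
  hs.trans_lt ((ha f hf).trans_le (le_localTime a y t f))

lemma vw_nonneg (hs : 0 ≤ s) (ha : ∀ g ∈ G.edgeFinset, s < a g) (y : ℕ → V) (t : ℕ) (v : V) :
    0 ≤ vw G (localTime a y t) v :=
  Finset.sum_nonneg fun j hj => (localTime_pos hs ha y t (by simpa using hj)).le

lemma degree_mul_lt_vw (ha : ∀ g ∈ G.edgeFinset, s < a g) (y : ℕ → V) (t : ℕ)
    {u v : V} (h : G.Adj u v) : G.degree u * s < vw G (localTime a y t) u := by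
  have : ∑ _j ∈ G.neighborFinset u, s < vw G (localTime a y t) u :=
    Finset.sum_lt_sum_of_nonempty ⟨v, by simpa using h⟩ fun j hj =>
      (ha _ (by simpa using hj)).trans_le (le_localTime a y t _)
  simpa using this

lemma errwStep_nonneg (ha : ∀ g ∈ G.edgeFinset, 0 < a g) (y : ℕ → V) (t : ℕ) :
    0 ≤ errwStep G a y t := by
  unfold errwStep
  split_ifs with h
  · exact div_nonneg (localTime_pos le_rfl ha y t (by simpa using h)).le
      (vw_nonneg le_rfl ha y t (y t))
  · exact le_rfl

lemma prod_gammaRatio_succ (y : ℕ → V) (t : ℕ) (h : G.Adj (y t) (y (t + 1))) :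
    ∏ f ∈ G.edgeFinset, gammaRatio s (a f) (crossings y (t + 1) f) =
      (∏ f ∈ G.edgeFinset, gammaRatio s (a f) (crossings y t f)) *
        (1 - s / localTime a y t s(y t, y (t + 1))) := by
  have : ∀ f, gammaRatio s (a f) (crossings y (t + 1) f) = gammaRatio s (a f) (crossings y t f) *
      if f = s(y t, y (t + 1)) then 1 - s / localTime a y t f else 1 := by
    intro f
    rw [crossings_succ]
    split_ifs
    · rw [gammaRatio_succ, localTime_eq]
    · simp
  simp only [this, Finset.prod_mul_distrib, Finset.prod_ite_eq']
  rw [if_pos (by simpa using h)]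

lemma prod_shiftedWeight_succ (hs : 0 ≤ s) (ha : ∀ g ∈ G.edgeFinset, s < a g) (y : ℕ → V) (t : ℕ)
    (h : G.Adj (y t) (y (t + 1))) :
    ∏ v : V, shiftedWeight G a y (t + 1) v ^ (G.degree v * s / 2) =
      (∏ v : V, shiftedWeight G a y t v ^ (G.degree v * s / 2)) *
        ((vw G (localTime a y t) (y t) + 2) / vw G (localTime a y t) (y t)) ^
          (G.degree (y t) * s / 2) := by
  have hv : 0 < vw G (localTime a y t) (y t) :=
    (mul_nonneg (Nat.cast_nonneg _) hs).trans_lt (degree_mul_lt_vw ha y t h)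
  have : ∀ v, shiftedWeight G a y (t + 1) v ^ (G.degree v * s / 2) =
      shiftedWeight G a y t v ^ (G.degree v * s / 2) * if v = y t then
        ((vw G (localTime a y t) v + 2) / vw G (localTime a y t) v) ^ (G.degree v * s / 2)
          else 1 := by
    intro v
    unfold shiftedWeight
    rw [vw_localTime_succ G a y t h]
    by_cases h1 : v = y t
    · subst h1
      rw [if_pos rfl, if_neg h.ne, if_pos rfl, if_pos rfl, if_neg h.ne, add_zero, add_zero,
        ← Real.mul_rpow hv.le (by positivity), mul_div_cancel₀ _ hv.ne']
      congr 1
      ring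
    · simp only [if_neg h1, mul_one]
      congr 1
      split_ifs <;> ring
  simp only [this, Finset.prod_mul_distrib, Finset.prod_ite_eq']
  simp

lemma comparison_nonneg (hs : 0 < s) (ha : ∀ g ∈ G.edgeFinset, s < a g) (y : ℕ → V) (t : ℕ) :
    0 ≤ comparison G a s y t := by
  refine mul_nonneg (Finset.prod_nonneg fun f hf => (gammaRatio_pos hs (ha f hf) _).le)
    (Finset.prod_nonneg fun v _ => Real.rpow_nonneg ?_ _)
  have := vw_nonneg hs.le ha y t v
  unfold shiftedWeight
  split_ifs <;> linarith

lemma errwStep_mul_comparison_le (hs : 0 < s) (ha : ∀ g ∈ G.edgeFinset, s < a g) (y : ℕ → V)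
    (t : ℕ) : errwStep G a y t * comparison G a s y (t + 1) ≤
      errwStep G (fun g => a g - s) y t * comparison G a s y t := by
  by_cases h : G.Adj (y t) (y (t + 1))
  swap
  · simp [errwStep, h]
  have hL := localTime_pos hs.le ha y t (f := s(y t, y (t + 1))) (by simpa using h)
  have hLs : s < localTime a y t s(y t, y (t + 1)) :=
    (ha _ (by simpa using h)).trans_le (le_localTime a y t _)
  have hd := degree_mul_lt_vw ha y t h
  have hd0 : 0 ≤ G.degree (y t) * s := mul_nonneg (Nat.cast_nonneg _) hs.le
  have hC := comparison_nonneg hs ha y t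
  have hsum : ∑ u ∈ G.neighborFinset (y t), localTime (fun g => a g - s) y t s(y t, u) =
      vw G (localTime a y t) (y t) - G.degree (y t) * s := by
    simp [localTime_sub, vw, Finset.sum_sub_distrib]
  have hsucc : comparison G a s y (t + 1) = comparison G a s y t *
      ((1 - s / localTime a y t s(y t, y (t + 1))) *
        ((vw G (localTime a y t) (y t) + 2) / vw G (localTime a y t) (y t)) ^
          (G.degree (y t) * s / 2)) := by
    unfold comparison
    rw [prod_gammaRatio_succ y t h, prod_shiftedWeight_succ hs.le ha y t h]
    ring
  rw [errwStep, errwStep, if_pos h, if_pos h, hsum, localTime_sub, hsucc]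
  change localTime a y t s(y t, y (t + 1)) / vw G (localTime a y t) (y t) * _ ≤ _
  have hbound := rpow_add_two_le hd0 hd
  set L := localTime a y t s(y t, y (t + 1))
  set W := vw G (localTime a y t) (y t)
  set D := G.degree (y t) * s
  have hW : 0 < W := hd0.trans_lt hd
  have hWD : 0 < W - D := sub_pos.2 hd
  calc L / W * (comparison G a s y t * ((1 - s / L) * ((W + 2) / W) ^ (D / 2)))
      = comparison G a s y t * ((L - s) / W) * ((W + 2) / W) ^ (D / 2) := by
        field_simp
    _ ≤ comparison G a s y t * ((L - s) / W) * (W / (W - D)) := by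
        refine mul_le_mul_of_nonneg_left hbound (mul_nonneg hC (div_nonneg ?_ hW.le))
        linarith
    _ = (L - s) / (W - D) * comparison G a s y t := by
        field_simp

lemma prod_errwStep_mul_comparison_le (hs : 0 < s) (ha : ∀ g ∈ G.edgeFinset, s < a g)
    (y : ℕ → V) (t : ℕ) :
    (∏ k ∈ Finset.range t, errwStep G a y k) * comparison G a s y t ≤
      (∏ k ∈ Finset.range t, errwStep G (fun g => a g - s) y k) * comparison G a s y 0 := by
  induction t with
  | zero => simp
  | succ t ih =>
    rw [Finset.prod_range_succ, Finset.prod_range_succ, mul_assoc]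
    have h0 : 0 ≤ ∏ k ∈ Finset.range t, errwStep G a y k :=
      Finset.prod_nonneg fun k _ => errwStep_nonneg (fun g hg => hs.trans (ha g hg)) y k
    have h1 : 0 ≤ errwStep G (fun g => a g - s) y t :=
      errwStep_nonneg (fun g hg => sub_pos.2 (ha g hg)) y t
    calc _ ≤ (∏ k ∈ Finset.range t, errwStep G a y k) *
          (errwStep G (fun g => a g - s) y t * comparison G a s y t) :=
          mul_le_mul_of_nonneg_left (errwStep_mul_comparison_le hs ha y t) h0
      _ = errwStep G (fun g => a g - s) y t *
          ((∏ k ∈ Finset.range t, errwStep G a y k) * comparison G a s y t) := by ring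
      _ ≤ _ := mul_le_mul_of_nonneg_left ih h1
      _ = _ := by ring

lemma comparison_zero_le (hs : 0 < s) (ha : ∀ g ∈ G.edgeFinset, s < a g) (y : ℕ → V) :
    comparison G a s y 0 ≤ ∏ v : V, (vw G a v + 1) ^ (G.degree v * s / 2) := by
  have h0 : localTime a y 0 = a := by
    funext f
    simp [localTime]
  have hv : ∀ v, 0 ≤ vw G a v := fun v => h0 ▸ vw_nonneg hs.le ha y 0 v
  have : ∀ f, crossings y 0 f = 0 := fun f => by simp [crossings]
  simp only [comparison, this, gammaRatio, Finset.range_zero, Finset.prod_empty,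
    Finset.prod_const_one, one_mul, shiftedWeight, h0]
  have hw : ∀ v, 0 ≤ vw G a v + (if v = y 0 then (0 : ℝ) else 1) := by
    intro v
    have := hv v
    split_ifs <;> linarith
  refine Finset.prod_le_prod (fun v _ => Real.rpow_nonneg (hw v) _) fun v _ =>
    Real.rpow_le_rpow (hw v) ?_ (by positivity)
  split_ifs <;> linarith

end Comparison

/-! ### Total mass of the trajectory law -/

lemma extendPath_snoc {T : ℕ} (v0 : V) (x : Fin (T + 1) → V) (v : V) {t : ℕ} (ht : t ≤ T) :
    extendPath (T := T + 1) v0 (Fin.snoc (α := fun _ => V) x v) t = extendPath v0 x t := by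
  have h1 : t < T + 1 := by omega
  have h2 : t < T + 1 + 1 := by omega
  simp [extendPath, h1, h2, Fin.snoc]

lemma extendPath_snoc_last {T : ℕ} (v0 : V) (x : Fin (T + 1) → V) (v : V) :
    extendPath (T := T + 1) v0 (Fin.snoc (α := fun _ => V) x v) (T + 1) = v := by
  simp [extendPath, Fin.snoc]

lemma localTime_congr (a : Sym2 V → ℝ) {y z : ℕ → V} {t : ℕ} (h : ∀ k ≤ t, y k = z k) :
    localTime a y t = localTime a z t := by
  funext f
  unfold localTime
  congr 3
  refine Finset.filter_congr fun k hk => ?_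
  have hk := Finset.mem_range.1 hk
  rw [h k hk.le, h (k + 1) hk]

lemma errwStep_congr (G : SimpleGraph V) [DecidableRel G.Adj] (a : Sym2 V → ℝ) {y z : ℕ → V}
    {t : ℕ} (h : ∀ k ≤ t + 1, y k = z k) : errwStep G a y t = errwStep G a z t := by
  unfold errwStep
  rw [localTime_congr a fun k hk => h k (hk.trans t.le_succ), h t t.le_succ, h (t + 1) le_rfl]

lemma errwProb_nonneg {G : SimpleGraph V} [DecidableRel G.Adj] {a : Sym2 V → ℝ}
    (ha : ∀ g ∈ G.edgeFinset, 0 < a g) (v0 : V) (T : ℕ) (x : Fin (T + 1) → V) :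
    0 ≤ errwProb G v0 a T x := by
  unfold errwProb
  split_ifs
  · exact Finset.prod_nonneg fun k _ => errwStep_nonneg ha _ k
  · exact le_rfl

lemma sum_errwProb_snoc_le {G : SimpleGraph V} [DecidableRel G.Adj] {a : Sym2 V → ℝ}
    (ha : ∀ g ∈ G.edgeFinset, 0 < a g) (v0 : V) (T : ℕ) (x : Fin (T + 1) → V) :
    ∑ v : V, errwProb G v0 a (T + 1) (Fin.snoc (α := fun _ => V) x v) ≤ errwProb G v0 a T x := by
  set y := extendPath v0 x
  have hstep : ∀ v, errwProb G v0 a (T + 1) (Fin.snoc (α := fun _ => V) x v) =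
      errwProb G v0 a T x * (if G.Adj (y T) v then
        localTime a y T s(y T, v) / vw G (localTime a y T) (y T) else 0) := by
    intro v
    have h0 : (Fin.snoc (α := fun _ => V) x v : Fin (T + 1 + 1) → V) 0 = x 0 := by
      simp [Fin.snoc]
    unfold errwProb
    rw [h0]
    split_ifs with hx hadj
    · rw [Finset.prod_range_succ]
      congr 1
      · refine Finset.prod_congr rfl fun k hk => errwStep_congr G a fun l hl => ?_
        exact extendPath_snoc v0 x v (hl.trans (Finset.mem_range.1 hk))
      · unfold errwStep
        rw [localTime_congr a fun k hk => extendPath_snoc v0 x v hk,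
          extendPath_snoc v0 x v le_rfl, extendPath_snoc_last, if_pos hadj]
        rfl
    · rw [Finset.prod_range_succ]
      unfold errwStep
      rw [extendPath_snoc v0 x v le_rfl, extendPath_snoc_last, if_neg hadj]
      simp
    · simp
    · simp
  simp only [hstep, ← Finset.mul_sum]
  refine mul_le_of_le_one_right (errwProb_nonneg ha v0 T x) ?_
  rw [← Finset.sum_filter, ← Finset.sum_div]
  have : (Finset.univ.filter fun v => G.Adj (y T) v) = G.neighborFinset (y T) := by
    ext v
    simp
  rw [this]
  exact div_self_le_one _

lemma sum_errwProb_le_one {G : SimpleGraph V} [DecidableRel G.Adj] {a : Sym2 V → ℝ}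
    (ha : ∀ g ∈ G.edgeFinset, 0 < a g) (v0 : V) (T : ℕ) :
    ∑ x : Fin (T + 1) → V, errwProb G v0 a T x ≤ 1 := by
  induction T with
  | zero =>
    rw [← (Equiv.funUnique (Fin 1) V).symm.sum_comp]
    simp [errwProb, Equiv.funUnique]
  | succ T ih =>
    refine le_trans ?_ ih
    rw [← (Fin.snocEquiv fun _ : Fin (T + 2) => V).sum_comp, Fintype.sum_prod_type_right]
    exact Finset.sum_le_sum fun x _ => sum_errwProb_snoc_le ha v0 T x

/-! ### Comparing local times -/

lemma prod_neighborFinset_edge (G : SimpleGraph V) [DecidableRel G.Adj] (g : Sym2 V → ℝ) :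
    ∏ v : V, ∏ j ∈ G.neighborFinset v, g s(v, j) = ∏ f ∈ G.edgeFinset, g f ^ 2 := by
  have h1 : ∏ v : V, ∏ j ∈ G.neighborFinset v, g s(v, j) = ∏ d : G.Dart, g d.edge := by
    rw [Finset.prod_sigma']
    refine Finset.prod_bij' (fun p hp => ⟨(p.1, p.2), by simpa using hp⟩)
      (fun d _ => ⟨d.fst, d.snd⟩) ?_ ?_ ?_ ?_ ?_ <;> simp
  rw [h1, ← Finset.prod_fiberwise_of_maps_to (t := G.edgeFinset) (g := fun d : G.Dart => d.edge)
    (fun d _ => by simp)]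
  refine Finset.prod_congr rfl fun f hf => ?_
  rw [Finset.prod_congr rfl (g := fun _ => g f) (by simp +contextual), Finset.prod_const]
  congr 1
  convert G.dart_edge_fiber_card f (by simpa using hf)

/-- Product over the edges `{v, j}` at `v` of `W_v / L_{vj}`. -/
def vertexRatio (G : SimpleGraph V) [DecidableRel G.Adj] (L : Sym2 V → ℝ) (v : V) : ℝ :=
  ∏ j ∈ G.neighborFinset v, vw G L v / L s(v, j)

section Ratio

variable {G : SimpleGraph V} [DecidableRel G.Adj] {L : Sym2 V → ℝ}

lemma le_vw_s18 (hL : ∀ g ∈ G.edgeFinset, 0 < L g) {u v : V} (h : G.Adj u v) :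
    L s(u, v) ≤ vw G L u :=
  Finset.single_le_sum (f := fun j => L s(u, j)) (fun j hj => (hL _ (by simpa using hj)).le)
    (by simpa using h)

lemma one_le_div_of_adj (hL : ∀ g ∈ G.edgeFinset, 0 < L g) {u v : V} (h : G.Adj u v) :
    1 ≤ vw G L u / L s(u, v) :=
  (one_le_div (hL _ (by simpa using h))).2 (le_vw_s18 hL h)

lemma one_le_vertexRatio (hL : ∀ g ∈ G.edgeFinset, 0 < L g) (v : V) :
    1 ≤ vertexRatio G L v :=
  Finset.one_le_prod fun j hj => one_le_div_of_adj hL (by simpa using hj)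

lemma vw_le_vertexRatio_mul (hL : ∀ g ∈ G.edgeFinset, 0 < L g) {u v : V} (h : G.Adj u v) :
    vw G L u ≤ vertexRatio G L u * L s(u, v) := by
  have hpos : 0 < L s(u, v) := hL _ (by simpa using h)
  rw [← div_le_iff₀ hpos]
  exact single_le_prod_of_one_le (f := fun j => vw G L u / L s(u, j))
    (fun j hj => one_le_div_of_adj hL (by simpa using hj)) (by simpa using h)

lemma vw_le_walk_prod_mul (hL : ∀ g ∈ G.edgeFinset, 0 < L g) {u v : V} (p : G.Walk u v) :
    vw G L u ≤ (p.support.map (vertexRatio G L)).prod * vw G L v := by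
  induction p with
  | nil =>
    rename_i u
    have h0 : 0 ≤ vw G L u := Finset.sum_nonneg fun j hj => (hL _ (by simpa using hj)).le
    simpa using le_mul_of_one_le_left h0 (one_le_vertexRatio hL u)
  | cons h p ih =>
    rename_i u v w
    have h1 := one_le_vertexRatio hL u
    rw [SimpleGraph.Walk.support_cons, List.map_cons, List.prod_cons, mul_assoc]
    refine (vw_le_vertexRatio_mul hL h).trans (mul_le_mul_of_nonneg_left ?_ (by linarith))
    refine le_trans ?_ ih
    rw [Sym2.eq_swap]
    exact le_vw_s18 hL h.symm

lemma vw_le_sq_mul (hG : G.Connected) (hL : ∀ g ∈ G.edgeFinset, 0 < L g) (u : V) {e : Sym2 V}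
    (he : e ∈ G.edgeFinset) : vw G L u ≤ (∏ v : V, vertexRatio G L v) ^ 2 * L e := by
  induction e with
  | h v w =>
    have hvw : G.Adj v w := by simpa using he
    have h1 : ∀ v, 1 ≤ vertexRatio G L v := one_le_vertexRatio hL
    have h0 : ∀ v, 0 ≤ vertexRatio G L v := fun v => zero_le_one.trans (h1 v)
    have hLe := hL _ he
    obtain ⟨p, hp⟩ := hG.exists_isPath u v
    have hprod : (p.support.map (vertexRatio G L)).prod ≤ ∏ v : V, vertexRatio G L v := by
      rw [← List.prod_toFinset _ hp.support_nodup]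
      exact Finset.prod_le_prod_of_subset_of_one_le (Finset.subset_univ _) (fun v _ => h0 v)
        fun v _ _ => h1 v
    have hv : vertexRatio G L v ≤ ∏ v : V, vertexRatio G L v :=
      single_le_prod_of_one_le (f := vertexRatio G L) (fun v _ => h1 v) (Finset.mem_univ v)
    calc vw G L u ≤ (p.support.map (vertexRatio G L)).prod * vw G L v := vw_le_walk_prod_mul hL p
      _ ≤ (∏ v : V, vertexRatio G L v) * ((∏ v : V, vertexRatio G L v) * L s(v, w)) := by
          refine mul_le_mul hprod ((vw_le_vertexRatio_mul hL hvw).trans ?_) ?_ ?_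
          · exact mul_le_mul_of_nonneg_right hv hLe.le
          · exact hLe.le.trans (le_vw_s18 hL hvw)
          · exact Finset.prod_nonneg fun v _ => h0 v
      _ = _ := by ring

lemma prod_vertexRatio_rpow (hL : ∀ g ∈ G.edgeFinset, 0 < L g) (s : ℝ) :
    (∏ v : V, vertexRatio G L v) ^ (s / 2) =
      (∏ f ∈ G.edgeFinset, L f ^ (-s)) * ∏ v : V, vw G L v ^ (G.degree v * s / 2) := by
  have hw : ∀ v, 0 ≤ vw G L v := fun v =>
    Finset.sum_nonneg fun j hj => (hL _ (by simpa using hj)).le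
  have hE : ∏ f ∈ G.edgeFinset, L f ^ (-s) =
      ∏ v : V, ∏ j ∈ G.neighborFinset v, L s(v, j) ^ (-(s / 2)) := by
    rw [prod_neighborFinset_edge G fun f => L f ^ (-(s / 2))]
    refine Finset.prod_congr rfl fun f hf => ?_
    rw [← Real.rpow_natCast, ← Real.rpow_mul (hL f hf).le]
    congr 1
    push_cast
    ring
  rw [hE, ← Finset.prod_mul_distrib, ← Real.finsetProd_rpow _ _
    fun v _ => zero_le_one.trans (one_le_vertexRatio hL v)]
  refine Finset.prod_congr rfl fun v _ => ?_
  unfold vertexRatio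
  rw [← Real.finsetProd_rpow _ _ fun j hj =>
    div_nonneg (hw v) (hL _ (by simpa using hj)).le]
  have hdeg : vw G L v ^ (G.degree v * s / 2) = ∏ _j ∈ G.neighborFinset v, vw G L v ^ (s / 2) := by
    rw [Finset.prod_const, G.card_neighborFinset_eq_degree, ← Real.rpow_natCast,
      ← Real.rpow_mul (hw v)]
    congr 1
    ring
  rw [hdeg, ← Finset.prod_mul_distrib]
  refine Finset.prod_congr rfl fun j hj => ?_
  have hj : 0 < L s(v, j) := hL _ (by simpa using hj)
  rw [Real.div_rpow (hw v) hj.le, Real.rpow_neg hj.le, div_eq_mul_inv, mul_comm]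

end Ratio

/-! ### Moment bound -/

lemma exists_mul_rpow_le_comparison {G : SimpleGraph V} [DecidableRel G.Adj] {a : Sym2 V → ℝ}
    {s : ℝ} (hs : 0 < s) (ha : ∀ g ∈ G.edgeFinset, s < a g) :
    ∃ c : ℝ, 0 < c ∧ ∀ (y : ℕ → V) (t : ℕ),
      c * (∏ v : V, vertexRatio G (localTime a y t) v) ^ (s / 2) ≤ comparison G a s y t := by
  have hex : ∀ f, ∃ c : ℝ, 0 < c ∧ (f ∈ G.edgeFinset →
      ∀ k : ℕ, c * (a f + k) ^ (-s) ≤ gammaRatio s (a f) k) := by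
    intro f
    by_cases hf : f ∈ G.edgeFinset
    · obtain ⟨c, hc, h⟩ := exists_mul_rpow_neg_le_gammaRatio hs (ha f hf)
      exact ⟨c, hc, fun _ => h⟩
    · exact ⟨1, one_pos, fun h => absurd h hf⟩
  choose c hc hcle using hex
  refine ⟨∏ f ∈ G.edgeFinset, c f, Finset.prod_pos fun f _ => hc f, fun y t => ?_⟩
  have hL : ∀ g ∈ G.edgeFinset, 0 < localTime a y t g := fun g hg => localTime_pos hs.le ha y t hg
  rw [prod_vertexRatio_rpow hL, ← mul_assoc, ← Finset.prod_mul_distrib]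
  unfold comparison
  refine mul_le_mul ?_ ?_ ?_ ?_
  · exact Finset.prod_le_prod
      (fun f hf => mul_nonneg (hc f).le (Real.rpow_nonneg (hL f hf).le _))
      fun f hf => hcle f hf _
  · refine Finset.prod_le_prod (fun v _ => Real.rpow_nonneg (vw_nonneg hs.le ha y t v) _)
      fun v _ => Real.rpow_le_rpow (vw_nonneg hs.le ha y t v) ?_ (by positivity)
    unfold shiftedWeight
    split_ifs <;> linarith
  · exact Finset.prod_nonneg fun v _ => Real.rpow_nonneg (vw_nonneg hs.le ha y t v) _
  · exact Finset.prod_nonneg fun f hf => (gammaRatio_pos hs (ha f hf) _).le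

/-- Moments of the ratio product are bounded uniformly in time. -/
lemma exists_sum_errwProb_mul_rpow_le {G : SimpleGraph V} [DecidableRel G.Adj] {a : Sym2 V → ℝ}
    {s : ℝ} (hs : 0 < s) (ha : ∀ g ∈ G.edgeFinset, s < a g) (v0 : V) :
    ∃ C : ℝ, ∀ T : ℕ, ∑ x : Fin (T + 1) → V, errwProb G v0 a T x *
      (∏ v : V, vertexRatio G (localTime a (extendPath v0 x) T) v) ^ (s / 2) ≤ C := by
  obtain ⟨c, hc, hcle⟩ := exists_mul_rpow_le_comparison hs ha
  set K := ∏ v : V, (vw G a v + 1) ^ (G.degree v * s / 2)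
  have hK : 0 ≤ K := (comparison_nonneg hs ha (fun _ => v0) 0).trans (comparison_zero_le hs ha _)
  have ha0 : ∀ g ∈ G.edgeFinset, 0 < a g := fun g hg => hs.trans (ha g hg)
  have has : ∀ g ∈ G.edgeFinset, 0 < a g - s := fun g hg => sub_pos.2 (ha g hg)
  refine ⟨K / c, fun T => ?_⟩
  have hpt : ∀ x : Fin (T + 1) → V, errwProb G v0 a T x *
      (∏ v : V, vertexRatio G (localTime a (extendPath v0 x) T) v) ^ (s / 2) ≤
        errwProb G v0 (fun g => a g - s) T x * (K / c) := by
    intro x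
    unfold errwProb
    split_ifs with hx
    · set y := extendPath v0 x
      have h0 : 0 ≤ ∏ k ∈ Finset.range T, errwStep G a y k :=
        Finset.prod_nonneg fun k _ => errwStep_nonneg ha0 y k
      have h1 : 0 ≤ ∏ k ∈ Finset.range T, errwStep G (fun g => a g - s) y k :=
        Finset.prod_nonneg fun k _ => errwStep_nonneg has y k
      rw [← mul_div_assoc, le_div_iff₀ hc]
      calc _ = (∏ k ∈ Finset.range T, errwStep G a y k) *
            (c * (∏ v : V, vertexRatio G (localTime a y T) v) ^ (s / 2)) := by ring
        _ ≤ (∏ k ∈ Finset.range T, errwStep G a y k) * comparison G a s y T :=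
            mul_le_mul_of_nonneg_left (hcle y T) h0
        _ ≤ _ := prod_errwStep_mul_comparison_le hs ha y T
        _ ≤ _ := mul_le_mul_of_nonneg_left (comparison_zero_le hs ha y) h1
    · simp
  refine (Finset.sum_le_sum fun x _ => hpt x).trans ?_
  rw [← Finset.sum_mul]
  exact mul_le_of_le_one_left (div_nonneg hK hc.le) (sum_errwProb_le_one has v0 T)

lemma adj_of_errwProb_ne_zero {G : SimpleGraph V} [DecidableRel G.Adj] {a : Sym2 V → ℝ} {v0 : V}
    {T : ℕ} {x : Fin (T + 1) → V} (h : errwProb G v0 a T x ≠ 0) {k : ℕ} (hk : k < T) :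
    G.Adj (extendPath v0 x k) (extendPath v0 x (k + 1)) := by
  unfold errwProb at h
  split_ifs at h
  · have := Finset.prod_ne_zero_iff.1 h k (Finset.mem_range.2 hk)
    by_contra hadj
    exact this (if_neg hadj)
  · exact absurd rfl h

lemma exists_div_card_le_vw {G : SimpleGraph V} [DecidableRel G.Adj] {a : Sym2 V → ℝ}
    (ha : ∀ g ∈ G.edgeFinset, 0 < a g) {e : Sym2 V} (he : e ∈ G.edgeFinset) {y : ℕ → V} {T : ℕ}
    (hy : ∀ k < T, G.Adj (y k) (y (k + 1))) :
    ∃ u, (T : ℝ) / G.edgeFinset.card ≤ vw G (localTime a y T) u := by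
  have hm : (0 : ℝ) < G.edgeFinset.card := Nat.cast_pos.2 (Finset.card_pos.2 ⟨e, he⟩)
  obtain ⟨f, hf, hle⟩ := Finset.exists_le_card_fiber_of_nsmul_le_card_of_maps_to
    (s := Finset.range T) (t := G.edgeFinset) (f := fun k => s(y k, y (k + 1)))
    (b := (T : ℝ) / G.edgeFinset.card)
    (fun k hk => by simpa using hy k (Finset.mem_range.1 hk)) ⟨e, he⟩
    (by rw [nsmul_eq_mul, mul_div_cancel₀ _ hm.ne', Finset.card_range])
  induction f with
  | h u w =>
    refine ⟨u, ?_⟩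
    have h1 := le_vw_s18 (L := localTime a y T) (u := u) (v := w)
      (fun g hg => localTime_pos le_rfl ha y T hg) (by simpa using hf)
    refine le_trans ?_ h1
    rw [localTime_eq]
    have h2 := ha _ hf
    have h3 : (T : ℝ) / G.edgeFinset.card ≤ crossings y T s(u, w) := by
      unfold crossings
      convert hle
    linarith

lemma inv_add_le_rpow {α γ r n : ℝ} (hα : 0 < α) (hγ : 0 < γ) (hr : r ≤ 1) (hn : 0 ≤ n) :
    1 / (n + γ) ≤ (1 + α / γ) * α ^ (r - 1) * (α + n) ^ (-r) := by
  have h1 : 0 < α + n := by linarith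
  have h2 : 1 / (n + γ) ≤ (1 + α / γ) * (α + n)⁻¹ := by
    rw [← div_eq_mul_inv, div_le_div_iff₀ (by linarith) h1]
    have h3 : 0 ≤ α / γ * n := by positivity
    have h4 : (1 + α / γ) * (n + γ) = n + γ + α / γ * n + α := by
      field_simp
      ring
    linarith
  have h5 : (α + n)⁻¹ ≤ α ^ (r - 1) * (α + n) ^ (-r) := by
    have h6 : (α + n)⁻¹ = (α + n) ^ (r - 1) * (α + n) ^ (-r) := by
      rw [← Real.rpow_add h1, ← Real.rpow_neg_one]
      congr 1
      ring
    rw [h6]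
    refine mul_le_mul_of_nonneg_right ?_ (Real.rpow_nonneg h1.le _)
    exact Real.rpow_le_rpow_of_nonpos hα (by linarith) (by linarith)
  calc _ ≤ _ := h2
    _ ≤ (1 + α / γ) * (α ^ (r - 1) * (α + n) ^ (-r)) := by gcongr
    _ = _ := by ring

/-- Inverse local times decay at every rate `r ≤ 1` with `4 r` below all initial weights. -/
lemma inverse_local_time_decay_of_lt (G : SimpleGraph V) [DecidableRel G.Adj] (hG : G.Connected)
    (v0 : V) (a : Sym2 V → ℝ) {r : ℝ} (hr : 0 < r) (hr1 : r ≤ 1)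
    (ha : ∀ g ∈ G.edgeFinset, 4 * r < a g) {e : Sym2 V} (he : e ∈ G.edgeFinset) {γ : ℝ}
    (hγ : 0 < γ) :
    ∃ C : ℝ, ∀ T : ℕ, 1 ≤ T → (∑ x : Fin (T + 1) → V, errwProb G v0 a T x *
      (1 / ((edgeCount v0 x e : ℝ) + γ))) ≤ C * (T : ℝ) ^ (-r) := by
  have hs : 0 < 4 * r := by linarith
  obtain ⟨C, hC⟩ := exists_sum_errwProb_mul_rpow_le hs ha v0
  have ha0 : ∀ g ∈ G.edgeFinset, 0 < a g := fun g hg => hs.trans (ha g hg)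
  set m : ℝ := (G.edgeFinset.card : ℝ)
  have hm : 0 < m := Nat.cast_pos.2 (Finset.card_pos.2 ⟨e, he⟩)
  set K : ℝ := (1 + a e / γ) * a e ^ (r - 1)
  have hae := ha0 e he
  have hK : 0 < K := by positivity
  refine ⟨K * m ^ r * C, fun T hT => ?_⟩
  have hT0 : (0 : ℝ) < T := by exact_mod_cast hT
  have hpt : ∀ x : Fin (T + 1) → V, errwProb G v0 a T x * (1 / ((edgeCount v0 x e : ℝ) + γ)) ≤
      K * m ^ r * (T : ℝ) ^ (-r) * (errwProb G v0 a T x *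
        (∏ v : V, vertexRatio G (localTime a (extendPath v0 x) T) v) ^ (4 * r / 2)) := by
    intro x
    by_cases hx : errwProb G v0 a T x = 0
    · simp [hx]
    set y := extendPath v0 x
    set Φ := ∏ v : V, vertexRatio G (localTime a y T) v
    have hL : ∀ g ∈ G.edgeFinset, 0 < localTime a y T g :=
      fun g hg => localTime_pos le_rfl ha0 y T hg
    have hΦ : 0 ≤ Φ := Finset.prod_nonneg fun v _ => zero_le_one.trans (one_le_vertexRatio hL v)
    have hLe := hL e he
    obtain ⟨u, hu⟩ := exists_div_card_le_vw ha0 he (y := y) (T := T)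
      fun k hk => adj_of_errwProb_ne_zero hx hk
    have h1 : (T : ℝ) / m ≤ Φ ^ 2 * localTime a y T e := hu.trans (vw_le_sq_mul hG hL u he)
    have h2 : ((T : ℝ) / m) ^ r ≤ Φ ^ (4 * r / 2) * localTime a y T e ^ r := by
      refine (Real.rpow_le_rpow (by positivity) h1 hr.le).trans_eq ?_
      rw [Real.mul_rpow (by positivity) hLe.le, ← Real.rpow_natCast, ← Real.rpow_mul hΦ]
      congr 2
      push_cast
      ring
    have h3 : localTime a y T e ^ (-r) ≤ m ^ r * (T : ℝ) ^ (-r) * Φ ^ (4 * r / 2) := by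
      rw [Real.div_rpow hT0.le hm.le, div_le_iff₀ (by positivity)] at h2
      rw [Real.rpow_neg hLe.le, Real.rpow_neg hT0.le, inv_le_iff_one_le_mul₀ (by positivity)]
      have hTr : 0 < (T : ℝ) ^ r := by positivity
      calc (1 : ℝ) = ((T : ℝ) ^ r)⁻¹ * (T : ℝ) ^ r := (inv_mul_cancel₀ hTr.ne').symm
        _ ≤ ((T : ℝ) ^ r)⁻¹ * (Φ ^ (4 * r / 2) * localTime a y T e ^ r * m ^ r) := by gcongr
        _ = _ := by ring
    have h4 : 1 / ((edgeCount v0 x e : ℝ) + γ) ≤ K * localTime a y T e ^ (-r) :=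
      inv_add_le_rpow hae hγ hr1 (Nat.cast_nonneg _)
    have hp := errwProb_nonneg ha0 v0 T x
    calc _ ≤ errwProb G v0 a T x * (K * (m ^ r * (T : ℝ) ^ (-r) * Φ ^ (4 * r / 2))) :=
          mul_le_mul_of_nonneg_left (h4.trans (mul_le_mul_of_nonneg_left h3 hK.le)) hp
      _ = _ := by ring
  refine (Finset.sum_le_sum fun x _ => hpt x).trans ?_
  rw [← Finset.mul_sum]
  calc _ ≤ K * m ^ r * (T : ℝ) ^ (-r) * C := mul_le_mul_of_nonneg_left (hC T) (by positivity)
    _ = _ := by ring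

/-- Inverse-local-time decay on a general graph.  If `a_g ≥ ā > 0` on
all edges, `e` is an edge, `γ > 0`, and `N_e(T)` is the traversal count of `e` by the ERRW
up to time `T`, then:
(i) if `ā ≤ 4 + 2√5`, for every `0 < r < min{ā/8, 3/4}` there is `C_r < ∞` with
`E[1/(N_e(T)+γ)] ≤ C_r·T^{−r}` for all `T ≥ 1`;
(ii) if `ā > 4 + 2√5`, there is `C < ∞` with `E[1/(N_e(T)+γ)] ≤ C/T` for all `T ≥ 1`. -/
theorem inverse_local_time_decay
    {V : Type*} [Fintype V] [DecidableEq V]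
    (G : SimpleGraph V) [DecidableRel G.Adj] (hG : G.Connected)
    (v0 : V) (a : Sym2 V → ℝ)
    (abar : ℝ) (habar : 0 < abar) (ha : ∀ g ∈ G.edgeFinset, abar ≤ a g)
    (e : Sym2 V) (he : e ∈ G.edgeFinset) (γ : ℝ) (hγ : 0 < γ) :
    ((abar ≤ 4 + 2 * Real.sqrt 5 →
      ∀ r : ℝ, 0 < r → r < min (abar / 8) (3 / 4) →
        ∃ C : ℝ, ∀ T : ℕ, 1 ≤ T →
          (∑ x : Fin (T + 1) → V, errwProb G v0 a T x *
              (1 / ((edgeCount v0 x e : ℝ) + γ)))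
            ≤ C * (T : ℝ) ^ (-r)) ∧
     (4 + 2 * Real.sqrt 5 < abar →
      ∃ C : ℝ, ∀ T : ℕ, 1 ≤ T →
        (∑ x : Fin (T + 1) → V, errwProb G v0 a T x *
            (1 / ((edgeCount v0 x e : ℝ) + γ)))
          ≤ C / T)) := by
  constructor
  · intro _ r hr hr'
    have h1 := hr'.trans_le (min_le_left _ _)
    have h2 := hr'.trans_le (min_le_right _ _)
    exact inverse_local_time_decay_of_lt G hG v0 a hr (by linarith)
      (fun g hg => lt_of_lt_of_le (by linarith) (ha g hg)) he hγ
  · intro h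
    have h5 := Real.sqrt_pos.2 (show (0 : ℝ) < 5 by norm_num)
    obtain ⟨C, hC⟩ := inverse_local_time_decay_of_lt G hG v0 a one_pos le_rfl
      (fun g hg => lt_of_lt_of_le (by linarith) (ha g hg)) he hγ
    refine ⟨C, fun T hT => ?_⟩
    rw [div_eq_mul_inv, ← Real.rpow_neg_one]
    exact hC T hT

end ERRW
end
end
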